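/- Let ρ₁ and ρ₂ be quantum states of dimensions d₁ and d₂, let {S_d}_{d≥1} satisfy Assumption 1′, suppose S_{d₁} contains a state whose support contains supp(ρ₁) and S_{d₂} contains a state whose support contains supp(ρ₂), and suppose each S_d is invariant under permutations of tensor factors whenever d is a power of d₁, d₂ or d₁d₂. Let σ_{0,j} be a minimizer of σ ↦ D(ρ_j‖σ) over S_{d_j} for j = 1,2. Then 𝔇(ρ₁^{⊗n} ⊗ ρ₂^{⊗m}) = n·𝔇(ρ₁) + m·𝔇(ρ₂) for all m, n ≥ 1, where 𝔇(X) denotes the minimum of D(X‖σ) over σ in the member of the family of the appropriate dimension, if and only if sup_{t ∈ ℝ, τ ∈ S_{d_j}} Tr[τ σ_{0,j}^{−(1+it)/2} ρ_j σ_{0,j}^{−(1−it)/2}] = 1 for both j = 1 and j = 2. -/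

import Mathlib

open scoped BigOperators ComplexOrder Classical
open MeasureTheory Filter Set

noncomputable section

namespace QHT

variable {ι : Type*} [Fintype ι] [DecidableEq ι]

/-- Generalized matrix power `A ^ w` (complex exponent `w`) of a Hermitian matrix,
via functional calculus on the support: the eigenvalue `0` is mapped to `0`. -/
def mpow (A : Matrix ι ι ℂ) (w : ℂ) : Matrix ι ι ℂ :=
  if hA : A.IsHermitian then
    (hA.eigenvectorUnitary : Matrix ι ι ℂ) *
      Matrix.diagonal (fun i => if hA.eigenvalues i = 0 then 0 else (hA.eigenvalues i : ℂ) ^ w) *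
      star (hA.eigenvectorUnitary : Matrix ι ι ℂ)
  else 0

/-- Matrix logarithm of a Hermitian matrix, taken on its support
(`Real.log 0 = 0`, so the kernel is mapped to `0`). -/
def mlog (A : Matrix ι ι ℂ) : Matrix ι ι ℂ :=
  if hA : A.IsHermitian then
    (hA.eigenvectorUnitary : Matrix ι ι ℂ) *
      Matrix.diagonal (fun i => (Real.log (hA.eigenvalues i) : ℂ)) *
      star (hA.eigenvectorUnitary : Matrix ι ι ℂ)
  else 0

/-- The support of a matrix, i.e. its range as a linear map. -/
def msupp (A : Matrix ι ι ℂ) : Submodule ℂ (ι → ℂ) := LinearMap.range A.mulVecLin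

/-- A quantum state: a positive semidefinite matrix of trace one. -/
def IsState (A : Matrix ι ι ℂ) : Prop := A.PosSemidef ∧ A.trace = 1

/-- Real part of the trace. -/
def rtr (A : Matrix ι ι ℂ) : ℝ := A.trace.re

/-- The Umegaki relative entropy `D(ρ‖σ)`, with value `+∞` when `supp ρ ⊄ supp σ`. -/
def relEnt (ρ σ : Matrix ι ι ℂ) : EReal :=
  if msupp ρ ≤ msupp σ then ((rtr (ρ * (mlog ρ - mlog σ)) : ℝ) : EReal) else ⊤

/-- The polar of a set of matrices (intersected with the PSD cone). -/
def polar (S : Set (Matrix ι ι ℂ)) : Set (Matrix ι ι ℂ) :=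
  {X | X.PosSemidef ∧ ∀ Y ∈ S, rtr (X * Y) ≤ 1}

/-- Entrywise Bochner integral of a matrix-valued function over `ℝ`. -/
def mInt (f : ℝ → Matrix ι ι ℂ) : Matrix ι ι ℂ :=
  Matrix.of fun i j => ∫ t : ℝ, f t i j

/-- Entrywise Bochner integral of a matrix-valued function over a set `s ⊆ ℝ`. -/
def mIntOn (f : ℝ → Matrix ι ι ℂ) (s : Set ℝ) : Matrix ι ι ℂ :=
  Matrix.of fun i j => ∫ t in s, f t i j

/-- `sinc` function. -/
def sinc (s : ℝ) : ℝ := if s = 0 then 1 else Real.sin s / s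

/-- The probability density `β_θ` from the paper (`β₀` is the `θ → 0` limit). -/
def betaDist (θ t : ℝ) : ℝ :=
  if θ = 0 then Real.pi / (2 * (Real.cosh (Real.pi * t) + 1))
  else Real.sin (θ * Real.pi) / (2 * θ * (Real.cosh (Real.pi * t) + Real.cos (θ * Real.pi)))

/-- `Q_{α,z}(ρ‖σ) = Tr[(ρ^{α/2z} σ^{(1-α)/z} ρ^{α/2z})^z]`. -/
def Qaz (α z : ℝ) (ρ σ : Matrix ι ι ℂ) : ℝ :=
  rtr (mpow (mpow ρ ((α / (2 * z) : ℝ) : ℂ) * mpow σ (((1 - α) / z : ℝ) : ℂ) *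
      mpow ρ ((α / (2 * z) : ℝ) : ℂ)) ((z : ℝ) : ℂ))

/-- The `α`-`z` Rényi relative entropy. -/
def Daz (α z : ℝ) (ρ σ : Matrix ι ι ℂ) : EReal :=
  if (α < 1 ∧ (ρ * σ).trace ≠ 0) ∨ msupp ρ ≤ msupp σ then
    (((α - 1)⁻¹ * Real.log (Qaz α z ρ σ) : ℝ) : EReal)
  else ⊤

/-- `Q_α(ρ‖σ) = Tr[ρ^α σ^{1-α}]` (Petz). -/
def Qpetz (α : ℝ) (ρ σ : Matrix ι ι ℂ) : ℝ :=
  rtr (mpow ρ ((α : ℝ) : ℂ) * mpow σ (((1 - α) : ℝ) : ℂ))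

/-- The Petz Rényi divergence. -/
def Dpetz (α : ℝ) (ρ σ : Matrix ι ι ℂ) : EReal :=
  if (α < 1 ∧ (ρ * σ).trace ≠ 0) ∨ msupp ρ ≤ msupp σ then
    (((α - 1)⁻¹ * Real.log (Qpetz α ρ σ) : ℝ) : EReal)
  else ⊤

/-- `Q̃_α(ρ‖σ) = Tr[(σ^{(1-α)/2α} ρ σ^{(1-α)/2α})^α]` (sandwiched). -/
def Qsand (α : ℝ) (ρ σ : Matrix ι ι ℂ) : ℝ :=
  rtr (mpow (mpow σ (((1 - α) / (2 * α) : ℝ) : ℂ) * ρ * mpow σ (((1 - α) / (2 * α) : ℝ) : ℂ))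
    ((α : ℝ) : ℂ))

/-- The sandwiched Rényi divergence. -/
def Dsand (α : ℝ) (ρ σ : Matrix ι ι ℂ) : EReal :=
  if (α < 1 ∧ (ρ * σ).trace ≠ 0) ∨ msupp ρ ≤ msupp σ then
    (((α - 1)⁻¹ * Real.log (Qsand α ρ σ) : ℝ) : EReal)
  else ⊤

/-- `D̃_∞(ρ‖σ)`: the limit of `D̃_α(ρ‖σ)` as `α → +∞` (encoded as a `limsup`; the limit
exists by monotonicity in `α`). -/
def DsandInf (ρ σ : Matrix ι ι ℂ) : EReal :=
  Filter.limsup (fun α : ℝ => Dsand α ρ σ) Filter.atTop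

/-- `χ_{α,z}(ρ,σ) = ρ^{α/2z} (ρ^{α/2z} σ^{(1-α)/z} ρ^{α/2z})^{z-1} ρ^{α/2z}`. -/
def chi (α z : ℝ) (ρ σ : Matrix ι ι ℂ) : Matrix ι ι ℂ :=
  mpow ρ ((α / (2 * z) : ℝ) : ℂ) *
    mpow (mpow ρ ((α / (2 * z) : ℝ) : ℂ) * mpow σ (((1 - α) / z : ℝ) : ℂ) *
      mpow ρ ((α / (2 * z) : ℝ) : ℂ)) (((z - 1 : ℝ)) : ℂ) *
    mpow ρ ((α / (2 * z) : ℝ) : ℂ)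

/-- The data-processing region `𝒟` for `α`-`z` Rényi relative entropies. -/
def Dregion : Set (ℝ × ℝ) :=
  {p | (0 < p.1 ∧ p.1 < 1 ∧ max p.1 (1 - p.1) ≤ p.2) ∨
       (1 < p.1 ∧ max (p.1 / 2) (p.1 - 1) ≤ p.2 ∧ p.2 ≤ p.1) ∨
       (p.1 = 1 ∧ 0 < p.2)}

end QHT

namespace QHT

variable {ι : Type*} [Fintype ι] [DecidableEq ι]

/-! ### Tensor products and many copies -/

/-- Tensor product of a `d₁`- and a `d₂`-dimensional operator, as a `d₁d₂`-dimensional one. -/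
def dtens {a b : ℕ} (A : Matrix (Fin a) (Fin a) ℂ) (B : Matrix (Fin b) (Fin b) ℂ) :
    Matrix (Fin (a * b)) (Fin (a * b)) ℂ :=
  Matrix.of fun x y =>
    A (finProdFinEquiv.symm x).1 (finProdFinEquiv.symm y).1 *
      B (finProdFinEquiv.symm x).2 (finProdFinEquiv.symm y).2

/-- `ρ^{⊗n}` of a `d`-dimensional operator, as a `d^n`-dimensional operator. -/
def dpow {d : ℕ} (ρ : Matrix (Fin d) (Fin d) ℂ) (n : ℕ) :
    Matrix (Fin (d ^ n)) (Fin (d ^ n)) ℂ :=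
  Matrix.of fun x y => ∏ i, ρ (finFunctionFinEquiv.symm x i) (finFunctionFinEquiv.symm y i)

/-- The action of a permutation of the `k` tensor factors on an operator on `(ℂ^d)^{⊗k}`. -/
def permMat (d k : ℕ) (π : Equiv.Perm (Fin k)) (A : Matrix (Fin (d ^ k)) (Fin (d ^ k)) ℂ) :
    Matrix (Fin (d ^ k)) (Fin (d ^ k)) ℂ :=
  Matrix.of fun x y =>
    A (finFunctionFinEquiv ((finFunctionFinEquiv.symm x) ∘ π))
      (finFunctionFinEquiv ((finFunctionFinEquiv.symm y) ∘ π))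

/-- `ρ^{⊗n}` of a `d`-dimensional operator, as an operator on `H^{⊗n}` with `H = ℂ^d`,
indexed by tuples. -/
def tpow {d : ℕ} (ρ : Matrix (Fin d) (Fin d) ℂ) (n : ℕ) :
    Matrix (Fin n → Fin d) (Fin n → Fin d) ℂ :=
  Matrix.of fun x y => ∏ i, ρ (x i) (y i)

/-- Tensor product of an operator on `H^{⊗m}` and an operator on `H^{⊗n}`, as an
operator on `H^{⊗(m+n)}`. -/
def tensOp {d m n : ℕ} (A : Matrix (Fin m → Fin d) (Fin m → Fin d) ℂ)
    (B : Matrix (Fin n → Fin d) (Fin n → Fin d) ℂ) :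
    Matrix (Fin (m + n) → Fin d) (Fin (m + n) → Fin d) ℂ :=
  Matrix.of fun x y =>
    A (fun i => x (Fin.castAdd n i)) (fun i => y (Fin.castAdd n i)) *
      B (fun j => x (Fin.natAdd m j)) (fun j => y (Fin.natAdd m j))

/-- Permutation action on operators on `H^{⊗k}`. -/
def permOp {d k : ℕ} (π : Equiv.Perm (Fin k))
    (A : Matrix (Fin k → Fin d) (Fin k → Fin d) ℂ) :
    Matrix (Fin k → Fin d) (Fin k → Fin d) ℂ :=
  Matrix.of fun x y => A (x ∘ π) (y ∘ π)

/-! ### Hypothesis testing -/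

/-- A test: an operator `T` with `0 ≤ T ≤ I`. -/
def IsTest (T : Matrix ι ι ℂ) : Prop := T.PosSemidef ∧ (1 - T).PosSemidef

/-- Type I error `α_n(ρ|T) = Tr[(I - T) ρ^{⊗n}]`. -/
def typeI {d : ℕ} (ρ : Matrix (Fin d) (Fin d) ℂ) (n : ℕ)
    (T : Matrix (Fin n → Fin d) (Fin n → Fin d) ℂ) : ℝ :=
  rtr ((1 - T) * tpow ρ n)

/-- Type II error `β_n(S|T) = sup_{σ ∈ S} Tr[σ T]`. -/
def typeII {d n : ℕ} (S : Set (Matrix (Fin n → Fin d) (Fin n → Fin d) ℂ))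
    (T : Matrix (Fin n → Fin d) (Fin n → Fin d) ℂ) : ℝ :=
  sSup ((fun σ => rtr (σ * T)) '' S)

/-- `- log x`, valued in `EReal`, with `- log x = +∞` for `x ≤ 0`. -/
def negLog (x : ℝ) : EReal := if x ≤ 0 then ⊤ else ((- Real.log x : ℝ) : EReal)

/-- The exponential rate `-(1/n) log x`. -/
def rate (n : ℕ) (x : ℝ) : EReal := (((n : ℝ)⁻¹ : ℝ) : EReal) * negLog x

/-- The Stein exponent `s(ρ‖{S_n})`. -/
def steinExp {d : ℕ} (ρ : Matrix (Fin d) (Fin d) ℂ)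
    (S : (n : ℕ) → Set (Matrix (Fin n → Fin d) (Fin n → Fin d) ℂ)) : EReal :=
  sSup ((fun r : ℝ => (r : EReal)) ''
    {r : ℝ | 0 ≤ r ∧ ∃ T : (n : ℕ) → Matrix (Fin n → Fin d) (Fin n → Fin d) ℂ,
      (∀ n, IsTest (T n)) ∧
      (r : EReal) ≤ Filter.liminf (fun n => rate n (typeII (S n) (T n))) Filter.atTop ∧
      Filter.Tendsto (fun n => typeI ρ n (T n)) Filter.atTop (nhds 0)})

/-- The Chernoff exponent `c(ρ‖{S_n})`. -/
def chernoffExp {d : ℕ} (ρ : Matrix (Fin d) (Fin d) ℂ)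
    (S : (n : ℕ) → Set (Matrix (Fin n → Fin d) (Fin n → Fin d) ℂ)) : EReal :=
  Filter.liminf (fun n =>
    rate n (sInf ((fun T => typeI ρ n T + typeII (S n) T) '' {T | IsTest T}))) Filter.atTop

/-- The Hoeffding (direct) exponent `d_r(ρ‖{S_n})`. -/
def hoeffdingExp {d : ℕ} (r : ℝ) (ρ : Matrix (Fin d) (Fin d) ℂ)
    (S : (n : ℕ) → Set (Matrix (Fin n → Fin d) (Fin n → Fin d) ℂ)) : EReal :=
  ⨆ T : {T : (n : ℕ) → Matrix (Fin n → Fin d) (Fin n → Fin d) ℂ //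
      (∀ n, IsTest (T n)) ∧
      (r : EReal) ≤ Filter.liminf (fun n => rate n (typeII (S n) (T n))) Filter.atTop},
    Filter.liminf (fun n => rate n (typeI ρ n (T.1 n))) Filter.atTop

/-- The strong converse exponent `sc_r(ρ‖{S_n})`. -/
def scExp {d : ℕ} (r : ℝ) (ρ : Matrix (Fin d) (Fin d) ℂ)
    (S : (n : ℕ) → Set (Matrix (Fin n → Fin d) (Fin n → Fin d) ℂ)) : EReal :=
  ⨅ T : {T : (n : ℕ) → Matrix (Fin n → Fin d) (Fin n → Fin d) ℂ //
      (∀ n, IsTest (T n)) ∧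
      (r : EReal) ≤ Filter.liminf (fun n => rate n (typeII (S n) (T n))) Filter.atTop},
    Filter.limsup (fun n => rate n (1 - typeI ρ n (T.1 n))) Filter.atTop

/-- Assumption 1 of the paper for a family `{S_n}_{n ≥ 1}` of sets of operators
on `H^{⊗n}`, `H = ℂ^d`: each `S_n` is a convex compact set of positive semidefinite
operators, closed under tensor products, and with polar sets closed under tensor
products. -/
structure Assumption1 {d : ℕ}
    (S : (n : ℕ) → Set (Matrix (Fin n → Fin d) (Fin n → Fin d) ℂ)) : Prop where
  psd : ∀ n, 1 ≤ n → ∀ X ∈ S n, X.PosSemidef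
  convex : ∀ n, 1 ≤ n → Convex ℝ (S n)
  compact : ∀ n, 1 ≤ n → IsCompact (S n)
  tens : ∀ m n, 1 ≤ m → 1 ≤ n → ∀ A ∈ S m, ∀ B ∈ S n, tensOp A B ∈ S (m + n)
  polarTens : ∀ m n, 1 ≤ m → 1 ≤ n →
    ∀ A ∈ polar (S m), ∀ B ∈ polar (S n), tensOp A B ∈ polar (S (m + n))

/-- Assumption 1′ of the paper for a dimension-indexed family `{S_d}_{d ≥ 1}`. -/
structure Assumption1' (S : (d : ℕ) → Set (Matrix (Fin d) (Fin d) ℂ)) : Prop where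
  psd : ∀ d, 1 ≤ d → ∀ X ∈ S d, X.PosSemidef
  convex : ∀ d, 1 ≤ d → Convex ℝ (S d)
  compact : ∀ d, 1 ≤ d → IsCompact (S d)
  tens : ∀ d₁ d₂, 1 ≤ d₁ → 1 ≤ d₂ → ∀ A ∈ S d₁, ∀ B ∈ S d₂, dtens A B ∈ S (d₁ * d₂)
  polarTens : ∀ d₁ d₂, 1 ≤ d₁ → 1 ≤ d₂ →
    ∀ A ∈ polar (S d₁), ∀ B ∈ polar (S d₂), dtens A B ∈ polar (S (d₁ * d₂))

end QHT

namespace QHT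

section

open scoped Matrix

section FunctionalCalculus

variable {ι : Type*} [Fintype ι] [DecidableEq ι]

/-- Functional calculus of a Hermitian matrix for a complex-valued function of the eigenvalues. -/
def fcalc (f : ℝ → ℂ) (A : Matrix ι ι ℂ) : Matrix ι ι ℂ :=
  if hA : A.IsHermitian then
    (hA.eigenvectorUnitary : Matrix ι ι ℂ) *
      Matrix.diagonal (fun i => f (hA.eigenvalues i)) *
      star (hA.eigenvectorUnitary : Matrix ι ι ℂ)
  else 0

/-- The function `x ↦ x ^ w`, mapping `0` to `0`. -/
def powFun (w : ℂ) (x : ℝ) : ℂ := if x = 0 then 0 else (x : ℂ) ^ w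

lemma mpow_eq_fcalc (A : Matrix ι ι ℂ) (w : ℂ) : mpow A w = fcalc (powFun w) A := rfl

lemma mlog_eq_fcalc (A : Matrix ι ι ℂ) : mlog A = fcalc (fun x => (Real.log x : ℂ)) A := rfl

lemma fcalc_of_isHermitian {A : Matrix ι ι ℂ} (hA : A.IsHermitian) (f : ℝ → ℂ) :
    fcalc f A = (hA.eigenvectorUnitary : Matrix ι ι ℂ) *
      Matrix.diagonal (fun i => f (hA.eigenvalues i)) *
      star (hA.eigenvectorUnitary : Matrix ι ι ℂ) := by
  simp [fcalc, hA]

lemma spectral_eq {A : Matrix ι ι ℂ} (hA : A.IsHermitian) :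
    A = (hA.eigenvectorUnitary : Matrix ι ι ℂ) *
      Matrix.diagonal (fun i => (hA.eigenvalues i : ℂ)) *
      star (hA.eigenvectorUnitary : Matrix ι ι ℂ) := by
  conv_lhs => rw [hA.spectral_theorem, Unitary.conjStarAlgAut_apply]
  rfl

lemma conj_diagonal_congr {U V : Matrix ι ι ℂ} (hU : U ∈ unitary (Matrix ι ι ℂ))
    (hV : V ∈ unitary (Matrix ι ι ℂ)) (a b : ι → ℝ) (f : ℝ → ℂ)
    (h : U * Matrix.diagonal (fun i => (a i : ℂ)) * star U =
      V * Matrix.diagonal (fun i => (b i : ℂ)) * star V) :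
    U * Matrix.diagonal (fun i => f (a i)) * star U =
      V * Matrix.diagonal (fun i => f (b i)) * star V := by
  have hU1 := (Unitary.mem_iff.1 hU).1
  have hU2 := (Unitary.mem_iff.1 hU).2
  have hV1 := (Unitary.mem_iff.1 hV).1
  have hV2 := (Unitary.mem_iff.1 hV).2
  have key : ∀ g : ℝ → ℂ, (star V * U) * Matrix.diagonal (fun i => g (a i)) =
      Matrix.diagonal (fun i => g (b i)) * (star V * U) →
      U * Matrix.diagonal (fun i => g (a i)) * star U =
      V * Matrix.diagonal (fun i => g (b i)) * star V := by
    intro g hg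
    calc _ = (V * star V) * U * Matrix.diagonal (fun i => g (a i)) * star U := by
          rw [hV2, one_mul]
      _ = V * ((star V * U) * Matrix.diagonal (fun i => g (a i))) * star U := by
          simp only [Matrix.mul_assoc]
      _ = V * Matrix.diagonal (fun i => g (b i)) * star V * (U * star U) := by
          rw [hg]; simp only [Matrix.mul_assoc]
      _ = _ := by rw [hU2, mul_one]
  apply key
  have h0 : (star V * U) * Matrix.diagonal (fun i => (a i : ℂ)) =
      Matrix.diagonal (fun i => (b i : ℂ)) * (star V * U) := by
    calc _ = star V * (U * Matrix.diagonal (fun i => (a i : ℂ)) * star U) * U := by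
          simp only [Matrix.mul_assoc, hU1, mul_one]
      _ = (star V * V) * Matrix.diagonal (fun i => (b i : ℂ)) * (star V * U) := by
          rw [h]; simp only [Matrix.mul_assoc]
      _ = _ := by rw [hV1, one_mul]
  ext i j
  have hij := congrFun (congrFun h0 i) j
  rw [Matrix.mul_diagonal, Matrix.diagonal_mul] at hij ⊢
  by_cases hz : (star V * U) i j = 0
  · simp [hz]
  · have : a j = b i := by
      have : ((a j : ℝ) : ℂ) = b i := by
        rw [mul_comm] at hij
        exact mul_right_cancel₀ hz hij
      exact_mod_cast this
    rw [this, mul_comm]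

lemma isHermitian_conj_diagonal (V : Matrix ι ι ℂ) (b : ι → ℝ) :
    (V * Matrix.diagonal (fun i => (b i : ℂ)) * star V).IsHermitian := by
  have : (Matrix.diagonal (fun i => (b i : ℂ))).IsHermitian := by
    rw [Matrix.isHermitian_diagonal_iff]
    intro i
    simp [isSelfAdjoint_iff]
  exact Matrix.isHermitian_mul_mul_conjTranspose V this

lemma fcalc_conj_diagonal {V : Matrix ι ι ℂ} (hV : V ∈ unitary (Matrix ι ι ℂ)) (b : ι → ℝ)
    (f : ℝ → ℂ) :
    fcalc f (V * Matrix.diagonal (fun i => (b i : ℂ)) * star V) =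
      V * Matrix.diagonal (fun i => f (b i)) * star V := by
  have hA := isHermitian_conj_diagonal V b
  rw [fcalc_of_isHermitian hA]
  exact conj_diagonal_congr hA.eigenvectorUnitary.2 hV _ _ f (spectral_eq hA).symm

lemma star_eigenvectorUnitary_mul {A : Matrix ι ι ℂ} (hA : A.IsHermitian) :
    star (hA.eigenvectorUnitary : Matrix ι ι ℂ) * (hA.eigenvectorUnitary : Matrix ι ι ℂ) = 1 :=
  (Unitary.mem_iff.1 hA.eigenvectorUnitary.2).1

lemma eigenvectorUnitary_mul_star {A : Matrix ι ι ℂ} (hA : A.IsHermitian) :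
    (hA.eigenvectorUnitary : Matrix ι ι ℂ) * star (hA.eigenvectorUnitary : Matrix ι ι ℂ) = 1 :=
  (Unitary.mem_iff.1 hA.eigenvectorUnitary.2).2

lemma fcalc_mul {A : Matrix ι ι ℂ} (hA : A.IsHermitian) (f g : ℝ → ℂ) :
    fcalc f A * fcalc g A = fcalc (fun x => f x * g x) A := by
  simp only [fcalc_of_isHermitian hA]
  rw [← Matrix.diagonal_mul_diagonal]
  calc _ = (hA.eigenvectorUnitary : Matrix ι ι ℂ) *
      Matrix.diagonal (fun i => f (hA.eigenvalues i)) *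
      (star (hA.eigenvectorUnitary : Matrix ι ι ℂ) * (hA.eigenvectorUnitary : Matrix ι ι ℂ)) *
      Matrix.diagonal (fun i => g (hA.eigenvalues i)) *
      star (hA.eigenvectorUnitary : Matrix ι ι ℂ) := by simp only [Matrix.mul_assoc]
    _ = _ := by rw [star_eigenvectorUnitary_mul]; simp only [Matrix.mul_assoc, mul_one]

lemma fcalc_id {A : Matrix ι ι ℂ} (hA : A.IsHermitian) : fcalc (fun x => (x : ℂ)) A = A := by
  rw [fcalc_of_isHermitian hA]
  exact (spectral_eq hA).symm

lemma fcalc_one {A : Matrix ι ι ℂ} (hA : A.IsHermitian) : fcalc (fun _ => 1) A = 1 := by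
  rw [fcalc_of_isHermitian hA, Matrix.diagonal_one, mul_one, eigenvectorUnitary_mul_star]

lemma fcalc_add (A : Matrix ι ι ℂ) (f g : ℝ → ℂ) :
    fcalc (fun x => f x + g x) A = fcalc f A + fcalc g A := by
  by_cases hA : A.IsHermitian
  · simp only [fcalc_of_isHermitian hA, ← Matrix.diagonal_add, Matrix.mul_add, Matrix.add_mul]
  · simp [fcalc, hA]

lemma fcalc_congr {A : Matrix ι ι ℂ} (hA : A.PosSemidef) {f g : ℝ → ℂ}
    (h : ∀ x, 0 ≤ x → f x = g x) : fcalc f A = fcalc g A := by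
  rw [fcalc_of_isHermitian hA.1, fcalc_of_isHermitian hA.1]
  simp only [h _ (hA.eigenvalues_nonneg _)]

/-- The projection onto the support of a Hermitian matrix. -/
def suppProj (A : Matrix ι ι ℂ) : Matrix ι ι ℂ := fcalc (powFun 0) A

lemma powFun_zero (w : ℂ) : powFun w 0 = 0 := by simp [powFun]

lemma suppProj_mul_self {A : Matrix ι ι ℂ} (hA : A.IsHermitian) : suppProj A * A = A := by
  have h := fcalc_mul hA (powFun 0) (fun x => (x : ℂ))
  rw [fcalc_id hA] at h
  rw [suppProj, h]
  conv_rhs => rw [← fcalc_id hA]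
  congr 1
  ext x
  by_cases hx : x = 0 <;> simp [powFun, hx]

lemma isHermitian_suppProj {A : Matrix ι ι ℂ} (hA : A.IsHermitian) :
    (suppProj A).IsHermitian := by
  rw [suppProj, fcalc_of_isHermitian hA]
  convert isHermitian_conj_diagonal (hA.eigenvectorUnitary : Matrix ι ι ℂ)
    (fun i => if hA.eigenvalues i = 0 then 0 else 1) using 5 with i
  by_cases hx : hA.eigenvalues i = 0 <;> simp [powFun, hx]

lemma self_mul_suppProj {A : Matrix ι ι ℂ} (hA : A.IsHermitian) : A * suppProj A = A := by
  have h := congrArg Matrix.conjTranspose (suppProj_mul_self hA)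
  rwa [Matrix.conjTranspose_mul, (isHermitian_suppProj hA).eq, hA.eq] at h

lemma suppProj_mul_of_mul_suppProj {A B : Matrix ι ι ℂ} (hA : A.IsHermitian)
    (hB : B.IsHermitian) (h : A * suppProj B = A) : suppProj B * A = A := by
  have h := congrArg Matrix.conjTranspose h
  rwa [Matrix.conjTranspose_mul, (isHermitian_suppProj hB).eq, hA.eq] at h

lemma self_mul_fcalc_inv {A : Matrix ι ι ℂ} (hA : A.IsHermitian) :
    A * fcalc (fun x => (x : ℂ)⁻¹) A = suppProj A := by
  have h := fcalc_mul hA (fun x => (x : ℂ)) (fun x => (x : ℂ)⁻¹)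
  rw [fcalc_id hA] at h
  rw [suppProj, h]
  congr 1
  ext x
  by_cases hx : x = 0 <;> simp [powFun, hx]

lemma fcalc_inv_mul_self {A : Matrix ι ι ℂ} (hA : A.IsHermitian) :
    fcalc (fun x => (x : ℂ)⁻¹) A * A = suppProj A := by
  have h := fcalc_mul hA (fun x => (x : ℂ)⁻¹) (fun x => (x : ℂ))
  rw [fcalc_id hA] at h
  rw [suppProj, h]
  congr 1
  ext x
  by_cases hx : x = 0 <;> simp [powFun, hx]

lemma msupp_le_iff {A B : Matrix ι ι ℂ} (hA : A.IsHermitian) (hB : B.IsHermitian) :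
    msupp A ≤ msupp B ↔ A * suppProj B = A := by
  constructor
  · intro h
    have h1 : suppProj B * A = A := by
      apply Matrix.ext_of_mulVec_single
      intro i
      obtain ⟨w, hw⟩ := h ⟨Pi.single i 1, rfl⟩
      simp only [Matrix.mulVecLin_apply] at hw
      rw [← Matrix.mulVec_mulVec, ← hw, Matrix.mulVec_mulVec, suppProj_mul_self hB]
    have h := congrArg Matrix.conjTranspose h1
    rwa [Matrix.conjTranspose_mul, (isHermitian_suppProj hB).eq, hA.eq] at h
  · intro h
    have h1 := suppProj_mul_of_mul_suppProj hA hB h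
    rintro _ ⟨v, rfl⟩
    refine ⟨(fcalc (fun x => (x : ℂ)⁻¹) B * A) *ᵥ v, ?_⟩
    rw [Matrix.mulVecLin_apply, Matrix.mulVecLin_apply, Matrix.mulVec_mulVec, ← Matrix.mul_assoc,
      self_mul_fcalc_inv hB, h1]

lemma mul_suppProj_eq_iff_mulVec {A B : Matrix ι ι ℂ} (hB : B.IsHermitian) :
    A * suppProj B = A ↔ ∀ v, B *ᵥ v = 0 → A *ᵥ v = 0 := by
  constructor
  · intro h v hv
    rw [← h, ← fcalc_inv_mul_self hB, ← Matrix.mulVec_mulVec, ← Matrix.mulVec_mulVec, hv,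
      Matrix.mulVec_zero, Matrix.mulVec_zero]
  · intro h
    apply Matrix.ext_of_mulVec_single
    intro i
    have h1 : B *ᵥ ((1 - suppProj B) *ᵥ Pi.single i 1) = 0 := by
      rw [Matrix.mulVec_mulVec, Matrix.mul_sub, self_mul_suppProj hB, mul_one, sub_self,
        Matrix.zero_mulVec]
    have h2 := h _ h1
    rw [Matrix.mulVec_mulVec, Matrix.mul_sub, mul_one, Matrix.sub_mulVec, sub_eq_zero] at h2
    exact h2.symm

/-- Conjugation of a matrix into the eigenbasis of a Hermitian matrix. -/
def eigConj {A : Matrix ι ι ℂ} (hA : A.IsHermitian) (M : Matrix ι ι ℂ) : Matrix ι ι ℂ :=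
  star (hA.eigenvectorUnitary : Matrix ι ι ℂ) * M * (hA.eigenvectorUnitary : Matrix ι ι ℂ)

/-- The weights occurring in a trace `Tr[T f(A) R g(A)]` expanded in the eigenbasis of `A`. -/
def eigWeight {A : Matrix ι ι ℂ} (hA : A.IsHermitian) (T R : Matrix ι ι ℂ) (i j : ι) : ℂ :=
  eigConj hA T j i * eigConj hA R i j

lemma trace_mul_fcalc_mul_fcalc {A : Matrix ι ι ℂ} (hA : A.IsHermitian) (T R : Matrix ι ι ℂ)
    (f g : ℝ → ℂ) :
    (T * (fcalc f A * R * fcalc g A)).trace =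
      ∑ i, ∑ j, eigWeight hA T R i j * (f (hA.eigenvalues i) * g (hA.eigenvalues j)) := by
  have h1 : (T * (fcalc f A * R * fcalc g A)).trace =
      ((eigConj hA T * Matrix.diagonal (fun i => f (hA.eigenvalues i))) *
        (eigConj hA R * Matrix.diagonal (fun i => g (hA.eigenvalues i)))).trace := by
    rw [fcalc_of_isHermitian hA, fcalc_of_isHermitian hA]
    simp only [eigConj, Matrix.mul_assoc]
    rw [Matrix.trace_mul_comm (star _)]
    simp only [Matrix.mul_assoc]
  rw [h1, Matrix.trace, Finset.sum_comm]
  refine Finset.sum_congr rfl fun j _ => ?_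
  rw [Matrix.diag_apply, Matrix.mul_apply]
  refine Finset.sum_congr rfl fun i _ => ?_
  rw [Matrix.mul_diagonal, Matrix.mul_diagonal, eigWeight]
  ring

lemma trace_mul_fcalc {A : Matrix ι ι ℂ} (hA : A.IsHermitian) (R : Matrix ι ι ℂ)
    (f : ℝ → ℂ) :
    (R * fcalc f A).trace = ∑ i, eigConj hA R i i * f (hA.eigenvalues i) := by
  rw [fcalc_of_isHermitian hA, ← Matrix.mul_assoc, Matrix.trace_mul_comm, ← Matrix.mul_assoc,
    ← Matrix.mul_assoc, Matrix.trace]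
  refine Finset.sum_congr rfl fun i _ => ?_
  rw [Matrix.diag_apply, Matrix.mul_diagonal, eigConj]

lemma eigConj_mul_powFun {A : Matrix ι ι ℂ} (hA : A.IsHermitian) {R : Matrix ι ι ℂ}
    (h : R * suppProj A = R) (i j : ι) (hj : hA.eigenvalues j = 0) : eigConj hA R i j = 0 := by
  have h1 : eigConj hA R = eigConj hA R *
      Matrix.diagonal (fun i => powFun 0 (hA.eigenvalues i)) := by
    conv_lhs => rw [← h, suppProj, fcalc_of_isHermitian hA]
    simp only [eigConj, Matrix.mul_assoc, star_eigenvectorUnitary_mul, mul_one]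
  rw [h1, Matrix.mul_diagonal, hj, powFun_zero, mul_zero]

lemma eigConj_isHermitian {A : Matrix ι ι ℂ} (hA : A.IsHermitian) {R : Matrix ι ι ℂ}
    (hR : R.IsHermitian) : (eigConj hA R).IsHermitian :=
  Matrix.isHermitian_conjTranspose_mul_mul _ hR

lemma eigWeight_eq_zero {A : Matrix ι ι ℂ} (hA : A.IsHermitian) {R : Matrix ι ι ℂ}
    (hR : R.IsHermitian) (h : R * suppProj A = R) (T : Matrix ι ι ℂ) (i j : ι)
    (hij : hA.eigenvalues i = 0 ∨ hA.eigenvalues j = 0) : eigWeight hA T R i j = 0 := by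
  rw [eigWeight]
  rcases hij with hi | hj
  · rw [← (eigConj_isHermitian hA hR).apply, eigConj_mul_powFun hA h j i hi, star_zero, mul_zero]
  · rw [eigConj_mul_powFun hA h i j hj, mul_zero]

lemma trace_eigConj {A : Matrix ι ι ℂ} (hA : A.IsHermitian) (R : Matrix ι ι ℂ) :
    ∑ i, eigConj hA R i i = R.trace := by
  have := trace_mul_fcalc hA R (fun _ => 1)
  rw [fcalc_one hA, mul_one] at this
  simp [this]

lemma eigConj_self {A : Matrix ι ι ℂ} (hA : A.IsHermitian) :
    eigConj hA A = Matrix.diagonal (fun i => (hA.eigenvalues i : ℂ)) := by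
  have h := spectral_eq hA
  rw [eigConj]
  nth_rewrite 2 [h]
  simp only [Matrix.mul_assoc, star_eigenvectorUnitary_mul, mul_one]
  rw [← Matrix.mul_assoc, star_eigenvectorUnitary_mul, one_mul]

end FunctionalCalculus

/-- The inverse of the logarithmic mean, i.e. the first divided difference of the logarithm. -/
def logDiv (x y : ℝ) : ℝ := if x = y then x⁻¹ else (Real.log x - Real.log y) / (x - y)

lemma hasDerivAt_log_add {x r : ℝ} (h : 0 < x + r) :
    HasDerivAt (fun s => Real.log (x + s)) ((x + r)⁻¹) r := by
  have := ((hasDerivAt_id r).const_add x).log h.ne'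
  simpa using this

lemma hasDerivAt_logDiv_add {x y r : ℝ} (hx : 0 < x + r) (hy : 0 < y + r) :
    HasDerivAt (fun s => logDiv (x + s) (y + s)) (-((x + r)⁻¹ * (y + r)⁻¹)) r := by
  by_cases hxy : x = y
  · subst hxy
    have h : HasDerivAt (fun s => (x + s)⁻¹) (-1 / (x + r) ^ 2) r :=
      ((hasDerivAt_id r).const_add x).inv hx.ne'
    have h2 : (fun s => logDiv (x + s) (x + s)) = fun s => (x + s)⁻¹ := by
      ext s; simp [logDiv]
    rw [h2]
    convert h using 1
    rw [← mul_inv, ← sq, neg_div, one_div]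
  · have h := ((hasDerivAt_log_add hx).sub (hasDerivAt_log_add hy)).div_const (x - y)
    have h2 : (fun s => logDiv (x + s) (y + s)) =
        fun s => (Real.log (x + s) - Real.log (y + s)) / (x - y) := by
      ext s
      simp [logDiv, hxy]
    rw [h2]
    have h3 : -((x + r)⁻¹ * (y + r)⁻¹) = ((x + r)⁻¹ - (y + r)⁻¹) / (x - y) := by
      have h4 : x - y ≠ 0 := sub_ne_zero.2 hxy
      rw [inv_sub_inv hx.ne' hy.ne', div_div, mul_comm, eq_div_iff (by positivity)]
      field_simp
      ring
    rw [h3]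
    exact h

lemma tendsto_log_add_sub_log (x : ℝ) :
    Tendsto (fun r => Real.log (x + r) - Real.log r) atTop (nhds 0) := by
  simpa only [add_comm x] using Real.tendsto_log_comp_add_sub_log x

lemma tendsto_logDiv_add (x y : ℝ) :
    Tendsto (fun s => logDiv (x + s) (y + s)) atTop (nhds 0) := by
  by_cases hxy : x = y
  · subst hxy
    have h2 : (fun s => logDiv (x + s) (x + s)) = fun s => (x + s)⁻¹ := by
      ext s; simp [logDiv]
    rw [h2]
    exact tendsto_inv_atTop_zero.comp (tendsto_atTop_add_const_left _ _ tendsto_id)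
  · have h := ((tendsto_log_add_sub_log x).sub (tendsto_log_add_sub_log y)).div_const (x - y)
    rw [sub_zero, zero_div] at h
    refine h.congr fun s => ?_
    simp [logDiv, hxy]

/-- The frequency `t` attached to a point of the unit interval: pushing the Lebesgue measure of
`(0, 1)` forward along this map gives the density `betaDist 0`. -/
def freq (y : ℝ) : ℝ := Real.log (y / (1 - y)) / Real.pi

lemma freq_surjective (t : ℝ) : ∃ y ∈ Ioo (0 : ℝ) 1, freq y = t := by
  have hE : 0 < Real.exp (Real.pi * t) := Real.exp_pos _
  refine ⟨Real.exp (Real.pi * t) / (1 + Real.exp (Real.pi * t)), ⟨by positivity, ?_⟩, ?_⟩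
  · rw [div_lt_one (by positivity)]; linarith
  · have h : Real.exp (Real.pi * t) / (1 + Real.exp (Real.pi * t)) /
        (1 - Real.exp (Real.pi * t) / (1 + Real.exp (Real.pi * t))) = Real.exp (Real.pi * t) := by
      have : 1 - Real.exp (Real.pi * t) / (1 + Real.exp (Real.pi * t)) =
          1 / (1 + Real.exp (Real.pi * t)) := by field_simp; ring
      rw [this]; field_simp
    rw [freq, h, Real.log_exp]
    field_simp

lemma continuousOn_freq : ContinuousOn freq (Ioo (0 : ℝ) 1) := by
  unfold freq
  refine ContinuousOn.div_const (ContinuousOn.log ?_ ?_) _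
  · exact continuousOn_id.div (continuousOn_const.sub continuousOn_id)
      fun y hy => (sub_pos.2 hy.2).ne'
  · exact fun y hy => (div_pos hy.1 (sub_pos.2 hy.2)).ne'

/-- The exponent appearing on the left of `ρ` at a frequency `t`. -/
def expL (t : ℝ) : ℂ := -((1 : ℂ) + Complex.I * (t : ℂ)) / 2

/-- The exponent appearing on the right of `ρ` at a frequency `t`. -/
def expR (t : ℝ) : ℂ := -((1 : ℂ) - Complex.I * (t : ℂ)) / 2

lemma betaIntegral_one_add_one_sub {z : ℂ} (hz : z.re = 0) (hz0 : z ≠ 0) :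
    Complex.betaIntegral (1 + z) (1 - z) = Real.pi * z / Complex.sin (Real.pi * z) := by
  have h := Complex.Gamma_mul_Gamma_eq_betaIntegral (s := 1 + z) (t := 1 - z)
    (by simp [hz]) (by simp [hz])
  have h2 : (1 + z) + (1 - z) = ((1 : ℕ) : ℂ) + 1 := by push_cast; ring
  rw [h2, Complex.Gamma_nat_eq_factorial, Nat.factorial_one, Nat.cast_one, one_mul] at h
  rw [← h, add_comm, Complex.Gamma_add_one z hz0, mul_assoc, Complex.Gamma_mul_Gamma_one_sub]
  ring

lemma betaIntegral_one_one : Complex.betaIntegral 1 1 = 1 := by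
  rw [Complex.betaIntegral_eval_one_right (by simp)]; simp

lemma powFun_expL_mul_powFun_expR {x y s : ℝ} (hx : 0 < x) (hy : 0 < y)
    (hs : s ∈ Ioo (0 : ℝ) 1) :
    powFun (expL (freq s)) x * powFun (expR (freq s)) y =
      (((Real.sqrt x * Real.sqrt y)⁻¹ : ℝ) : ℂ) *
      ((s : ℂ) ^ ((1 - Complex.I * (((Real.log x - Real.log y) / (2 * Real.pi) : ℝ) : ℂ)) - 1) *
       (1 - (s : ℂ)) ^
        ((1 + Complex.I * (((Real.log x - Real.log y) / (2 * Real.pi) : ℝ) : ℂ)) - 1)) := by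
  have hs1 : 0 < 1 - s := sub_pos.2 hs.2
  have h1 : (1 - (s : ℂ)) = ((1 - s : ℝ) : ℂ) := by push_cast; ring
  have e : ∀ u : ℝ, 0 < u → ∀ w : ℂ, (u : ℂ) ^ w = Complex.exp ((Real.log u : ℂ) * w) := by
    intro u hu w
    rw [Complex.cpow_def_of_ne_zero (by exact_mod_cast hu.ne'), Complex.ofReal_log hu.le]
  have hsq : ((Real.sqrt x * Real.sqrt y)⁻¹ : ℝ) =
      Real.exp (-(Real.log x / 2) - Real.log y / 2) := by
    rw [sub_eq_add_neg, Real.exp_add, Real.exp_neg, Real.exp_neg, Real.exp_half, Real.exp_half,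
      Real.exp_log hx, Real.exp_log hy, mul_inv]
  rw [powFun, powFun, if_neg hx.ne', if_neg hy.ne', h1, e x hx, e y hy, e s hs.1, e _ hs1, hsq,
    Complex.ofReal_exp, ← Complex.exp_add, ← Complex.exp_add, ← Complex.exp_add]
  congr 1
  rw [expL, expR, freq, Real.log_div hs.1.ne' hs1.ne']
  have : (Real.pi : ℂ) ≠ 0 := by exact_mod_cast Real.pi_ne_zero
  push_cast
  field_simp
  ring

lemma intervalIntegrable_powFun {x y : ℝ} (hx : 0 < x) (hy : 0 < y) :
    IntervalIntegrable (fun s => powFun (expL (freq s)) x * powFun (expR (freq s)) y)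
      volume 0 1 := by
  have h := (Complex.betaIntegral_convergent
    (u := 1 - Complex.I * (((Real.log x - Real.log y) / (2 * Real.pi) : ℝ) : ℂ))
    (v := 1 + Complex.I * (((Real.log x - Real.log y) / (2 * Real.pi) : ℝ) : ℂ))
    (by rw [Complex.sub_re, Complex.I_mul_re, Complex.ofReal_im]; norm_num)
    (by rw [Complex.add_re, Complex.I_mul_re, Complex.ofReal_im]; norm_num)).const_mul (((Real.sqrt x * Real.sqrt y)⁻¹ : ℝ) : ℂ)
  rw [intervalIntegrable_iff_integrableOn_Ioo_of_le zero_le_one] at h ⊢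
  exact h.congr_fun (fun s hs => (powFun_expL_mul_powFun_expR hx hy hs).symm) measurableSet_Ioo

lemma integral_powFun {x y : ℝ} (hx : 0 < x) (hy : 0 < y) :
    ∫ s in (0 : ℝ)..1, powFun (expL (freq s)) x * powFun (expR (freq s)) y =
      ((logDiv x y : ℝ) : ℂ) := by
  have h1 : ∫ s in (0 : ℝ)..1, powFun (expL (freq s)) x * powFun (expR (freq s)) y =
      (((Real.sqrt x * Real.sqrt y)⁻¹ : ℝ) : ℂ) *
      Complex.betaIntegral
        (1 - Complex.I * (((Real.log x - Real.log y) / (2 * Real.pi) : ℝ) : ℂ))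
        (1 + Complex.I * (((Real.log x - Real.log y) / (2 * Real.pi) : ℝ) : ℂ)) := by
    rw [Complex.betaIntegral, ← intervalIntegral.integral_const_mul,
      intervalIntegral.integral_of_le zero_le_one, intervalIntegral.integral_of_le zero_le_one,
      integral_Ioc_eq_integral_Ioo, integral_Ioc_eq_integral_Ioo]
    exact setIntegral_congr_fun measurableSet_Ioo
      fun s hs => powFun_expL_mul_powFun_expR hx hy hs
  rw [h1, Complex.betaIntegral_symm]
  by_cases hxy : x = y
  · subst hxy
    rw [sub_self, zero_div, Complex.ofReal_zero, mul_zero, add_zero, sub_zero,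
      betaIntegral_one_one, mul_one, Real.mul_self_sqrt hx.le, logDiv, if_pos rfl]
  · have hlog : Real.log x - Real.log y ≠ 0 := by
      rw [sub_ne_zero]
      exact fun h => hxy (Real.log_injOn_pos hx hy h)
    have hpi := Real.pi_ne_zero
    set u := Real.log x - Real.log y with hu
    have hz0 : Complex.I * ((u / (2 * Real.pi) : ℝ) : ℂ) ≠ 0 := by
      refine mul_ne_zero Complex.I_ne_zero ?_
      exact_mod_cast div_ne_zero hlog (by positivity)
    rw [betaIntegral_one_add_one_sub
      (by rw [Complex.I_mul_re, Complex.ofReal_im, neg_zero]) hz0]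
    have h2 : (Real.pi : ℂ) * (Complex.I * ((u / (2 * Real.pi) : ℝ) : ℂ)) =
        ((u / 2 : ℝ) : ℂ) * Complex.I := by
      have : (Real.pi : ℂ) ≠ 0 := by exact_mod_cast hpi
      push_cast
      field_simp
    rw [h2, Complex.sin_mul_I, mul_div_mul_right _ _ Complex.I_ne_zero, ← Complex.ofReal_sinh,
      ← Complex.ofReal_div, ← Complex.ofReal_mul, logDiv, if_neg hxy, ← hu]
    congr 1
    have h3 : Real.sqrt x = Real.exp (Real.log x / 2) := by
      rw [Real.exp_half, Real.exp_log hx]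
    have h4 : Real.sqrt y = Real.exp (Real.log y / 2) := by
      rw [Real.exp_half, Real.exp_log hy]
    have h5 : Real.sqrt x * Real.sqrt y * (2 * Real.sinh (u / 2)) = x - y := by
      have h6 : u / 2 = Real.log x / 2 - Real.log y / 2 := by rw [hu]; ring
      rw [Real.sinh_eq, h6, neg_sub, Real.exp_sub, Real.exp_sub, ← h3, ← h4]
      have := (Real.sqrt_pos.2 hx).ne'
      have := (Real.sqrt_pos.2 hy).ne'
      field_simp
      rw [Real.sq_sqrt hx.le, Real.sq_sqrt hy.le]
    rw [← h5]
    ring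

section SingleSystem

variable {ι : Type*} [Fintype ι] [DecidableEq ι]

omit [DecidableEq ι] in
lemma rtr_add (A B : Matrix ι ι ℂ) : rtr (A + B) = rtr A + rtr B := by
  simp [rtr]

omit [DecidableEq ι] in
lemma rtr_sub (A B : Matrix ι ι ℂ) : rtr (A - B) = rtr A - rtr B := by
  simp [rtr]

open scoped MatrixOrder Matrix.Norms.L2Operator in
lemma rtr_mul_nonneg {A B : Matrix ι ι ℂ} (hA : A.PosSemidef) (hB : B.PosSemidef) :
    0 ≤ rtr (A * B) := by
  obtain ⟨C, rfl⟩ := CStarAlgebra.nonneg_iff_eq_star_mul_self.mp hA.nonneg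
  have h := (hB.mul_mul_conjTranspose_same C).trace_nonneg
  rw [rtr, Matrix.star_eq_conjTranspose, Matrix.mul_assoc, Matrix.trace_mul_comm]
  exact (Complex.le_def.1 h).1

/-- The resolvent `(A + r)⁻¹` of a Hermitian matrix. -/
def resolvent (A : Matrix ι ι ℂ) (r : ℝ) : Matrix ι ι ℂ :=
  fcalc (fun x => (((x + r)⁻¹ : ℝ) : ℂ)) A

lemma resolvent_eq_inv {A : Matrix ι ι ℂ} (hA : A.PosSemidef) {r : ℝ} (hr : 0 < r) :
    resolvent A r = (A + (r : ℂ) • 1)⁻¹ := by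
  symm
  apply Matrix.inv_eq_right_inv
  have h1 : A + (r : ℂ) • 1 = fcalc (fun x => (x : ℂ) + (r : ℂ) * 1) A := by
    rw [fcalc_add A (fun x => (x : ℂ)) (fun _ => (r : ℂ) * 1), fcalc_id hA.1]
    congr 1
    have h := fcalc_one hA.1
    rw [fcalc_of_isHermitian hA.1] at h ⊢
    have h2 : Matrix.diagonal (fun _ : ι => (r : ℂ) * 1) =
        (r : ℂ) • Matrix.diagonal (fun _ : ι => (1 : ℂ)) := by
      ext i j
      by_cases hij : i = j <;> simp [hij]
    rw [h2, Matrix.mul_smul, Matrix.smul_mul, h]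
  rw [h1, resolvent, fcalc_mul hA.1, ← fcalc_one hA.1]
  apply fcalc_congr hA
  intro x hx
  have : (x : ℂ) + r ≠ 0 := by exact_mod_cast (add_pos_of_nonneg_of_pos hx hr).ne'
  push_cast
  field_simp

omit [Fintype ι] in
lemma posDef_add_smul_one {A : Matrix ι ι ℂ} (hA : A.PosSemidef) {r : ℝ} (hr : 0 < r) :
    (A + (r : ℂ) • (1 : Matrix ι ι ℂ)).PosDef := by
  have h : ((r : ℂ) • (1 : Matrix ι ι ℂ)).PosDef :=
    Matrix.PosDef.one.smul (by exact_mod_cast hr)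
  exact Matrix.PosDef.posSemidef_add hA h

lemma inv_ge_tangent {A B : Matrix ι ι ℂ} (hA : A.PosDef) (hB : B.PosDef) :
    (B⁻¹ - (A⁻¹ - A⁻¹ * (B - A) * A⁻¹)).PosSemidef := by
  have hA1 : A⁻¹ * A = 1 := Matrix.nonsing_inv_mul _ (Matrix.isUnit_iff_isUnit_det _ |>.1 hA.isUnit)
  have hB1 : B⁻¹ * B = 1 := Matrix.nonsing_inv_mul _ (Matrix.isUnit_iff_isUnit_det _ |>.1 hB.isUnit)
  have hA2 : A * A⁻¹ = 1 := Matrix.mul_nonsing_inv _ (Matrix.isUnit_iff_isUnit_det _ |>.1 hA.isUnit)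
  have hB2 : B * B⁻¹ = 1 := Matrix.mul_nonsing_inv _ (Matrix.isUnit_iff_isUnit_det _ |>.1 hB.isUnit)
  have h1 : A⁻¹ * (B - A) * A⁻¹ = A⁻¹ * B * A⁻¹ - A⁻¹ := by
    rw [Matrix.mul_sub, hA1, Matrix.sub_mul, one_mul]
  have h : B⁻¹ - (A⁻¹ - A⁻¹ * (B - A) * A⁻¹) =
      (A⁻¹ * (B - A)) * B⁻¹ * (A⁻¹ * (B - A))ᴴ := by
    have hd : (B - A).IsHermitian := hB.1.sub hA.1
    rw [Matrix.conjTranspose_mul, hd.eq, hA.1.inv.eq, h1]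
    have e1 : A⁻¹ * (B - A) * B⁻¹ = A⁻¹ - B⁻¹ := by
      rw [Matrix.mul_sub, hA1, Matrix.sub_mul, Matrix.mul_assoc, hB2, mul_one, one_mul]
    have e2 : (B - A) * A⁻¹ = B * A⁻¹ - 1 := by rw [Matrix.sub_mul, hA2]
    rw [e1, e2, Matrix.sub_mul, Matrix.mul_sub, Matrix.mul_sub, mul_one, mul_one,
      ← Matrix.mul_assoc, ← Matrix.mul_assoc, hB1, one_mul]
    abel
  rw [h]
  exact hB.inv.posSemidef.mul_mul_conjTranspose_same _

/-- The integrand `Tr[τ (σ + r)⁻¹ ρ (σ + r)⁻¹]`. -/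
def resTrace (ρ σ τ : Matrix ι ι ℂ) (r : ℝ) : ℝ :=
  rtr (τ * (resolvent σ r * ρ * resolvent σ r))

lemma isHermitian_resolvent {A : Matrix ι ι ℂ} (hA : A.IsHermitian) (r : ℝ) :
    (resolvent A r).IsHermitian := by
  rw [resolvent, fcalc_of_isHermitian hA]
  exact isHermitian_conj_diagonal _ _

lemma resTrace_nonneg {ρ σ τ : Matrix ι ι ℂ} (hρ : ρ.PosSemidef) (hσ : σ.IsHermitian)
    (hτ : τ.PosSemidef) (r : ℝ) : 0 ≤ resTrace ρ σ τ r := by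
  refine rtr_mul_nonneg hτ ?_
  have := hρ.mul_mul_conjTranspose_same (resolvent σ r)
  rwa [(isHermitian_resolvent hσ r).eq] at this

lemma rtr_mul_resolvent_ge {ρ σ τ : Matrix ι ι ℂ} (hρ : ρ.PosSemidef) (hσ : σ.PosSemidef)
    (hτ : τ.PosSemidef) {r : ℝ} (hr : 0 < r) :
    rtr (ρ * resolvent σ r) - (resTrace ρ σ τ r - resTrace ρ σ σ r) ≤
      rtr (ρ * resolvent τ r) := by
  have h := rtr_mul_nonneg hρ
    (inv_ge_tangent (posDef_add_smul_one hσ hr) (posDef_add_smul_one hτ hr))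
  rw [← resolvent_eq_inv hσ hr, ← resolvent_eq_inv hτ hr, add_sub_add_right_eq_sub,
    Matrix.mul_sub, Matrix.mul_sub, rtr_sub, rtr_sub] at h
  have e : ∀ M : Matrix ι ι ℂ, rtr (ρ * (resolvent σ r * M * resolvent σ r)) =
      resTrace ρ σ M r := by
    intro M
    rw [resTrace, rtr, rtr, Matrix.mul_assoc, ← Matrix.mul_assoc, Matrix.trace_mul_comm,
      Matrix.mul_assoc, Matrix.mul_assoc]
  rw [e] at h
  have e2 : resTrace ρ σ (τ - σ) r = resTrace ρ σ τ r - resTrace ρ σ σ r := by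
    simp only [resTrace, Matrix.sub_mul, rtr_sub]
  linarith

/-- `Tr[ρ log(σ + r)]`, expanded in the eigenbasis of `σ`. -/
def logTrace {σ : Matrix ι ι ℂ} (hσ : σ.IsHermitian) (ρ : Matrix ι ι ℂ) (r : ℝ) : ℝ :=
  ∑ i, (eigConj hσ ρ i i).re * Real.log (hσ.eigenvalues i + r)

/-- `Tr[τ Dlog[σ + r](ρ)]`, expanded in the eigenbasis of `σ`. -/
def dlogTrace {σ : Matrix ι ι ℂ} (hσ : σ.IsHermitian) (ρ τ : Matrix ι ι ℂ) (r : ℝ) : ℝ :=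
  ∑ i, ∑ j, (eigWeight hσ τ ρ i j).re * logDiv (hσ.eigenvalues i + r) (hσ.eigenvalues j + r)

lemma logTrace_zero {σ : Matrix ι ι ℂ} (hσ : σ.IsHermitian) (ρ : Matrix ι ι ℂ) :
    logTrace hσ ρ 0 = rtr (ρ * mlog σ) := by
  rw [mlog_eq_fcalc, rtr, trace_mul_fcalc hσ, Complex.re_sum, logTrace]
  simp

lemma rtr_mul_resolvent {σ : Matrix ι ι ℂ} (hσ : σ.IsHermitian) (ρ : Matrix ι ι ℂ) (r : ℝ) :
    rtr (ρ * resolvent σ r) = ∑ i, (eigConj hσ ρ i i).re * (hσ.eigenvalues i + r)⁻¹ := by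
  rw [resolvent, rtr, trace_mul_fcalc hσ, Complex.re_sum]
  simp only [Complex.re_mul_ofReal]

lemma resTrace_eq_sum {σ : Matrix ι ι ℂ} (hσ : σ.IsHermitian) (ρ τ : Matrix ι ι ℂ) (r : ℝ) :
    resTrace ρ σ τ r = ∑ i, ∑ j, (eigWeight hσ τ ρ i j).re *
      ((hσ.eigenvalues i + r)⁻¹ * (hσ.eigenvalues j + r)⁻¹) := by
  rw [resTrace, resolvent, rtr, trace_mul_fcalc_mul_fcalc hσ, Complex.re_sum]
  refine Finset.sum_congr rfl fun i _ => ?_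
  rw [Complex.re_sum]
  refine Finset.sum_congr rfl fun j _ => ?_
  rw [← Complex.ofReal_mul, Complex.re_mul_ofReal]

lemma hasDerivAt_logTrace {ρ σ : Matrix ι ι ℂ} (hσ : σ.PosSemidef)
    (hρσ : ρ * suppProj σ = ρ) {r : ℝ} (hr : 0 ≤ r) :
    HasDerivAt (logTrace hσ.1 ρ) (rtr (ρ * resolvent σ r)) r := by
  rw [rtr_mul_resolvent hσ.1]
  refine HasDerivAt.fun_sum fun i _ => ?_
  rcases (hσ.eigenvalues_nonneg i).eq_or_lt with h | h
  · rw [eigConj_mul_powFun hσ.1 hρσ i i h.symm]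
    simpa using hasDerivAt_const r (0 : ℝ)
  · exact (hasDerivAt_log_add (by positivity)).const_mul _

lemma hasDerivAt_dlogTrace {ρ σ : Matrix ι ι ℂ} (hρ : ρ.IsHermitian) (hσ : σ.PosSemidef)
    (hρσ : ρ * suppProj σ = ρ) (τ : Matrix ι ι ℂ) {r : ℝ} (hr : 0 ≤ r) :
    HasDerivAt (dlogTrace hσ.1 ρ τ) (-resTrace ρ σ τ r) r := by
  rw [resTrace_eq_sum hσ.1, ← Finset.sum_neg_distrib]
  refine HasDerivAt.fun_sum fun i _ => ?_
  rw [← Finset.sum_neg_distrib]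
  refine HasDerivAt.fun_sum fun j _ => ?_
  by_cases hz : hσ.1.eigenvalues i = 0 ∨ hσ.1.eigenvalues j = 0
  · rw [eigWeight_eq_zero hσ.1 hρ hρσ τ i j hz]
    simpa using hasDerivAt_const r (0 : ℝ)
  · push Not at hz
    have h1 := (hσ.eigenvalues_nonneg i).lt_of_ne' hz.1
    have h2 := (hσ.eigenvalues_nonneg j).lt_of_ne' hz.2
    rw [← mul_neg]
    exact (hasDerivAt_logDiv_add (by positivity) (by positivity)).const_mul _

lemma tendsto_dlogTrace {σ : Matrix ι ι ℂ} (hσ : σ.IsHermitian) (ρ τ : Matrix ι ι ℂ) :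
    Tendsto (dlogTrace hσ ρ τ) atTop (nhds 0) := by
  have : Tendsto (dlogTrace hσ ρ τ) atTop
      (nhds (∑ i, ∑ j, (eigWeight hσ τ ρ i j).re * 0)) :=
    tendsto_finsetSum _ fun i _ => tendsto_finsetSum _ fun j _ =>
      (tendsto_logDiv_add _ _).const_mul _
  simpa using this

lemma tendsto_logTrace {ρ σ : Matrix ι ι ℂ} (hσ : σ.IsHermitian) :
    Tendsto (fun r => logTrace hσ ρ r - rtr ρ * Real.log r) atTop (nhds 0) := by
  have h : Tendsto (fun r => ∑ i, (eigConj hσ ρ i i).re *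
      (Real.log (hσ.eigenvalues i + r) - Real.log r)) atTop
      (nhds (∑ i, (eigConj hσ ρ i i).re * 0)) :=
    tendsto_finsetSum _ fun i _ => (tendsto_log_add_sub_log _).const_mul _
  simp only [mul_zero, Finset.sum_const_zero] at h
  refine h.congr fun r => ?_
  simp only [mul_sub, Finset.sum_sub_distrib, ← Finset.sum_mul, logTrace]
  rw [rtr, ← trace_eigConj hσ, Complex.re_sum]

/-- The tangent inequality for the concave function `σ ↦ Tr[ρ log σ]`. -/
lemma logTrace_le_tangent {ρ σ τ : Matrix ι ι ℂ} (hρ : ρ.PosSemidef) (hσ : σ.PosSemidef)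
    (hτ : τ.PosSemidef) (hρσ : ρ * suppProj σ = ρ) (hρτ : ρ * suppProj τ = ρ) :
    rtr (ρ * mlog τ) - rtr (ρ * mlog σ) ≤ dlogTrace hσ.1 ρ τ 0 - dlogTrace hσ.1 ρ σ 0 := by
  let G : ℝ → ℝ := fun r => logTrace hτ.1 ρ r - logTrace hσ.1 ρ r -
    (dlogTrace hσ.1 ρ τ r - dlogTrace hσ.1 ρ σ r)
  have hd : ∀ r, 0 ≤ r → HasDerivAt G (rtr (ρ * resolvent τ r) - rtr (ρ * resolvent σ r) -
      (-resTrace ρ σ τ r - -resTrace ρ σ σ r)) r := fun r hr =>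
    ((hasDerivAt_logTrace hτ hρτ hr).sub (hasDerivAt_logTrace hσ hρσ hr)).sub
      ((hasDerivAt_dlogTrace hρ.1 hσ hρσ τ hr).sub (hasDerivAt_dlogTrace hρ.1 hσ hρσ σ hr))
  have hmono : MonotoneOn G (Ici 0) := by
    refine monotoneOn_of_deriv_nonneg (convex_Ici 0)
      (fun r hr => (hd r hr).continuousAt.continuousWithinAt)
      (fun r hr => ?_) (fun r hr => ?_)
    · rw [interior_Ici] at hr
      exact (hd r (le_of_lt hr)).differentiableAt.differentiableWithinAt
    · rw [interior_Ici] at hr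
      rw [(hd r (le_of_lt hr)).deriv]
      have := rtr_mul_resolvent_ge hρ hσ hτ (r := r) hr
      linarith
  have hlim : Tendsto G atTop (nhds 0) := by
    have := ((tendsto_logTrace (ρ := ρ) hτ.1).sub (tendsto_logTrace (ρ := ρ) hσ.1)).sub
      ((tendsto_dlogTrace hσ.1 ρ τ).sub (tendsto_dlogTrace hσ.1 ρ σ))
    simp only [sub_zero, sub_sub_sub_cancel_right] at this
    exact this
  have h0 : G 0 ≤ 0 := by
    refine ge_of_tendsto hlim ?_
    filter_upwards [eventually_ge_atTop 0] with r hr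
    exact hmono (mem_Ici.2 le_rfl) hr hr
  simp only [G, logTrace_zero] at h0
  linarith

lemma dlogTrace_self {ρ σ : Matrix ι ι ℂ} (hσ : σ.PosSemidef)
    (hρσ : ρ * suppProj σ = ρ) : dlogTrace hσ.1 ρ σ 0 = rtr ρ := by
  rw [rtr, ← trace_eigConj hσ.1, Complex.re_sum, dlogTrace]
  refine Finset.sum_congr rfl fun i _ => ?_
  rw [Finset.sum_eq_single i]
  · rcases eq_or_ne (hσ.1.eigenvalues i) 0 with h | h
    · rw [eigWeight, eigConj_mul_powFun hσ.1 hρσ i i h]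
      simp
    · rw [eigWeight, eigConj_self, Matrix.diagonal_apply_eq, Complex.re_ofReal_mul, logDiv,
        if_pos rfl, add_zero]
      field_simp
  · intro j _ hj
    rw [eigWeight, eigConj_self, Matrix.diagonal_apply_ne _ hj]
    simp
  · simp

lemma eigWeight_add_smul {σ : Matrix ι ι ℂ} (hσ : σ.IsHermitian) (ρ A B : Matrix ι ι ℂ)
    (a b : ℝ) (i j : ι) :
    (eigWeight hσ (a • A + b • B) ρ i j).re =
      a * (eigWeight hσ A ρ i j).re + b * (eigWeight hσ B ρ i j).re := by
  have : eigWeight hσ (a • A + b • B) ρ i j =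
      (a : ℂ) * eigWeight hσ A ρ i j + (b : ℂ) * eigWeight hσ B ρ i j := by
    simp only [eigWeight, eigConj, Matrix.mul_add, Matrix.add_mul, Matrix.mul_smul,
      Matrix.smul_mul, Matrix.add_apply, Matrix.smul_apply, Complex.real_smul]
    ring
  rw [this, Complex.add_re, Complex.re_ofReal_mul, Complex.re_ofReal_mul]

lemma dlogTrace_add_smul {σ : Matrix ι ι ℂ} (hσ : σ.IsHermitian) (ρ A B : Matrix ι ι ℂ)
    (a b r : ℝ) :
    dlogTrace hσ ρ (a • A + b • B) r = a * dlogTrace hσ ρ A r + b * dlogTrace hσ ρ B r := by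
  simp only [dlogTrace, eigWeight_add_smul, Finset.mul_sum, ← Finset.sum_add_distrib]
  refine Finset.sum_congr rfl fun i _ => Finset.sum_congr rfl fun j _ => ?_
  ring

lemma ofReal_dlogTrace {ρ σ τ : Matrix ι ι ℂ} (hρ : ρ.PosSemidef) (hσ : σ.PosSemidef)
    (hτ : τ.PosSemidef) (hρσ : ρ * suppProj σ = ρ) :
    ENNReal.ofReal (dlogTrace hσ.1 ρ τ 0) =
      ∫⁻ r in Ioi (0 : ℝ), ENNReal.ofReal (resTrace ρ σ τ r) := by
  have hc := (hasDerivAt_dlogTrace hρ.1 hσ hρσ τ le_rfl).continuousAt.continuousWithinAt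
    (s := Ici (0 : ℝ))
  have hd : ∀ r ∈ Ioi (0 : ℝ), HasDerivAt (dlogTrace hσ.1 ρ τ) (-resTrace ρ σ τ r) r :=
    fun r hr => hasDerivAt_dlogTrace hρ.1 hσ hρσ τ (le_of_lt hr)
  have hn : ∀ r ∈ Ioi (0 : ℝ), -resTrace ρ σ τ r ≤ 0 := fun r _ =>
    neg_nonpos.2 (resTrace_nonneg hρ hσ.1 hτ r)
  have hi := integrableOn_Ioi_deriv_of_nonpos hc hd hn (tendsto_dlogTrace hσ.1 ρ τ)
  have h := integral_Ioi_of_hasDerivAt_of_nonpos hc hd hn (tendsto_dlogTrace hσ.1 ρ τ)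
  rw [integral_neg, zero_sub, neg_inj] at h
  have hi2 : IntegrableOn (fun r => resTrace ρ σ τ r) (Ioi 0) := by
    simpa using hi.neg
  rw [← h, ofReal_integral_eq_lintegral_ofReal hi2
    (Eventually.of_forall fun r => resTrace_nonneg hρ hσ.1 hτ r)]

lemma measurable_resTrace (ρ : Matrix ι ι ℂ) {σ : Matrix ι ι ℂ} (hσ : σ.IsHermitian)
    (τ : Matrix ι ι ℂ) : Measurable (resTrace ρ σ τ) := by
  have : resTrace ρ σ τ = fun r => ∑ i, ∑ j, (eigWeight hσ τ ρ i j).re *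
      ((hσ.eigenvalues i + r)⁻¹ * (hσ.eigenvalues j + r)⁻¹) := by
    ext r
    exact resTrace_eq_sum hσ ρ τ r
  rw [this]
  fun_prop

lemma tendsto_resTrace {ρ τ σ : Matrix ι ι ℂ} {u : ℕ → Matrix ι ι ℂ} (hσ : σ.PosSemidef)
    (hu : ∀ k, (u k).PosSemidef) (hlim : Tendsto u atTop (nhds σ)) {r : ℝ} (hr : 0 < r) :
    Tendsto (fun k => resTrace ρ (u k) τ r) atTop (nhds (resTrace ρ σ τ r)) := by
  simp only [resTrace, fun k => resolvent_eq_inv (hu k) hr, resolvent_eq_inv hσ hr]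
  have hdet : (σ + (r : ℂ) • (1 : Matrix ι ι ℂ)).det ≠ 0 :=
    ((Matrix.isUnit_iff_isUnit_det _).1 (posDef_add_smul_one hσ hr).isUnit).ne_zero
  have hinv : ContinuousAt (fun M : Matrix ι ι ℂ => (M + (r : ℂ) • 1)⁻¹) σ := by
    simp only [Matrix.inv_def, Ring.inverse_eq_inv]
    refine ContinuousAt.smul (f := fun M : Matrix ι ι ℂ => ((M + (r : ℂ) • 1).det)⁻¹)
      (g := fun M : Matrix ι ι ℂ => (M + (r : ℂ) • 1).adjugate) ?_ ?_
    · refine ContinuousAt.inv₀ ?_ hdet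
      exact Continuous.continuousAt (by fun_prop)
    · refine Continuous.continuousAt ?_
      exact Continuous.matrix_adjugate (by fun_prop)
  have hcont : ContinuousAt (fun M : Matrix ι ι ℂ =>
      rtr (τ * ((M + (r : ℂ) • 1)⁻¹ * ρ * (M + (r : ℂ) • 1)⁻¹))) σ := by
    have h : Continuous fun N : Matrix ι ι ℂ => rtr (τ * (N * ρ * N)) := by
      unfold rtr
      exact Complex.continuous_re.comp (Continuous.matrix_trace (by fun_prop))
    exact ContinuousAt.comp (g := fun N : Matrix ι ι ℂ => rtr (τ * (N * ρ * N)))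
      h.continuousAt hinv
  exact hcont.tendsto.comp hlim

end SingleSystem

section Minimizers

variable {ι : Type*} [Fintype ι] [DecidableEq ι]

lemma relEnt_of_mul_suppProj {ρ σ : Matrix ι ι ℂ} (hρ : ρ.IsHermitian) (hσ : σ.IsHermitian)
    (h : ρ * suppProj σ = ρ) :
    relEnt ρ σ = ((rtr (ρ * mlog ρ) - rtr (ρ * mlog σ) : ℝ) : EReal) := by
  rw [relEnt, if_pos ((msupp_le_iff hρ hσ).2 h), Matrix.mul_sub, rtr_sub]

lemma relEnt_of_mul_suppProj_ne {ρ σ : Matrix ι ι ℂ} (hρ : ρ.IsHermitian) (hσ : σ.IsHermitian)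
    (h : ρ * suppProj σ ≠ ρ) : relEnt ρ σ = ⊤ := by
  rw [relEnt, if_neg (mt (msupp_le_iff hρ hσ).1 h)]

lemma mul_suppProj_of_convexComb {ρ σ τ : Matrix ι ι ℂ} (hσ : σ.PosSemidef)
    (hτ : τ.PosSemidef) (hρσ : ρ * suppProj σ = ρ) {a b : ℝ} (ha : 0 < a) (hb : 0 ≤ b) :
    ρ * suppProj (a • σ + b • τ) = ρ := by
  have hps : (a • σ + b • τ).PosSemidef := (hσ.smul ha.le).add (hτ.smul hb)
  rw [mul_suppProj_eq_iff_mulVec hps.1]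
  intro v hv
  refine (mul_suppProj_eq_iff_mulVec hσ.1).1 hρσ v ?_
  rw [← hσ.dotProduct_mulVec_zero_iff]
  have h0 := (hps.dotProduct_mulVec_zero_iff v).2 hv
  rw [Matrix.add_mulVec, dotProduct_add] at h0
  have h1 := (hσ.smul ha.le).dotProduct_mulVec_nonneg v
  have h2 := (hτ.smul hb).dotProduct_mulVec_nonneg v
  have h3 := ((add_eq_zero_iff_of_nonneg h1 h2).1 h0).1
  rw [Matrix.smul_mulVec, dotProduct_smul] at h3
  exact (smul_eq_zero.1 h3).resolve_left ha.ne'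

lemma relEnt_le_of_dlogTrace_le {ρ σ τ : Matrix ι ι ℂ} (hρ : IsState ρ) (hσ : σ.PosSemidef)
    (hτ : τ.PosSemidef) (hρσ : ρ * suppProj σ = ρ) (h : dlogTrace hσ.1 ρ τ 0 ≤ 1) :
    relEnt ρ σ ≤ relEnt ρ τ := by
  by_cases hρτ : ρ * suppProj τ = ρ
  · rw [relEnt_of_mul_suppProj hρ.1.1 hσ.1 hρσ, relEnt_of_mul_suppProj hρ.1.1 hτ.1 hρτ,
      EReal.coe_le_coe_iff]
    have h1 := logTrace_le_tangent hρ.1 hσ hτ hρσ hρτ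
    have h2 : rtr ρ = 1 := by rw [rtr, hρ.2, Complex.one_re]
    rw [dlogTrace_self hσ hρσ, h2] at h1
    linarith
  · rw [relEnt_of_mul_suppProj_ne hρ.1.1 hτ.1 hρτ]
    exact le_top

lemma dlogTrace_le_one_of_relEnt_le {ρ σ τ : Matrix ι ι ℂ} (hρ : IsState ρ)
    (hσ : σ.PosSemidef) (hτ : τ.PosSemidef) (hρσ : ρ * suppProj σ = ρ)
    (hmin : ∀ s : ℝ, 0 < s → s < 1 → relEnt ρ σ ≤ relEnt ρ ((1 - s) • σ + s • τ)) :
    dlogTrace hσ.1 ρ τ 0 ≤ 1 := by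
  have hps : ∀ s : ℝ, 0 < s → s < 1 → ((1 - s) • σ + s • τ).PosSemidef := fun s h0 h1 =>
    (hσ.smul (sub_nonneg.2 h1.le)).add (hτ.smul h0.le)
  have hsupp : ∀ s : ℝ, 0 < s → s < 1 → ρ * suppProj ((1 - s) • σ + s • τ) = ρ :=
    fun s h0 h1 => mul_suppProj_of_convexComb hσ hτ hρσ (sub_pos.2 h1) h0.le
  have hρ1 : rtr ρ = 1 := by rw [rtr, hρ.2, Complex.one_re]
  have hseg : ∀ s : ℝ, ∀ h0 : 0 < s, ∀ h1 : s < 1,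
      dlogTrace (hps s h0 h1).1 ρ τ 0 ≤ 1 := by
    intro s h0 h1
    have hle := hmin s h0 h1
    rw [relEnt_of_mul_suppProj hρ.1.1 hσ.1 hρσ,
      relEnt_of_mul_suppProj hρ.1.1 (hps s h0 h1).1 (hsupp s h0 h1),
      EReal.coe_le_coe_iff] at hle
    have ht := logTrace_le_tangent hρ.1 (hps s h0 h1) hσ (hsupp s h0 h1) hρσ
    have hself := dlogTrace_self (hps s h0 h1) (hsupp s h0 h1)
    rw [hself, hρ1] at ht
    have hlin := dlogTrace_add_smul (hps s h0 h1).1 ρ σ τ (1 - s) s 0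
    rw [hself, hρ1] at hlin
    nlinarith
  let s : ℕ → ℝ := fun k => 1 / ((k : ℝ) + 2)
  have hs0 : ∀ k, 0 < s k := fun k => by positivity
  have hs1 : ∀ k, s k < 1 := fun k => by
    rw [div_lt_one (by positivity)]
    have : (0 : ℝ) ≤ k := by positivity
    linarith
  have hs : Tendsto s atTop (nhds 0) :=
    (tendsto_const_nhds (x := (1 : ℝ))).div_atTop
      (tendsto_atTop_add_const_right _ _ tendsto_natCast_atTop_atTop)
  let u : ℕ → Matrix ι ι ℂ := fun k => (1 - s k) • σ + s k • τ
  have hu : ∀ k, (u k).PosSemidef := fun k => hps _ (hs0 k) (hs1 k)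
  have hlim : Tendsto u atTop (nhds σ) := by
    have : Tendsto u atTop (nhds ((1 - (0 : ℝ)) • σ + (0 : ℝ) • τ)) :=
      ((tendsto_const_nhds.sub hs).smul_const σ).add (hs.smul_const τ)
    simpa using this
  rw [← ENNReal.ofReal_le_one, ofReal_dlogTrace hρ.1 hσ hτ hρσ]
  calc ∫⁻ r in Ioi (0 : ℝ), ENNReal.ofReal (resTrace ρ σ τ r)
      = ∫⁻ r in Ioi (0 : ℝ), liminf (fun k => ENNReal.ofReal (resTrace ρ (u k) τ r)) atTop := by
        refine setLIntegral_congr_fun measurableSet_Ioi fun r hr => ?_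
        exact ((ENNReal.continuous_ofReal.tendsto _).comp
          (tendsto_resTrace hσ hu hlim hr)).liminf_eq.symm
    _ ≤ liminf (fun k => ∫⁻ r in Ioi (0 : ℝ), ENNReal.ofReal (resTrace ρ (u k) τ r)) atTop :=
        lintegral_liminf_le fun k => (measurable_resTrace ρ (hu k).1 τ).ennreal_ofReal
    _ ≤ liminf (fun _ : ℕ => (1 : ENNReal)) atTop := by
        refine liminf_le_liminf (Eventually.of_forall fun k => ?_)
        rw [← ofReal_dlogTrace hρ.1 (hu k) hτ (hsupp _ (hs0 k) (hs1 k)), ENNReal.ofReal_le_one]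
        exact hseg _ (hs0 k) (hs1 k)
    _ = 1 := liminf_const 1

/-- A point `σ` of a convex set minimizes `D(ρ‖·)` over it iff the differential of
`Tr[ρ log ·]` at `σ` is bounded by one on the set. -/
lemma relEnt_minimizer_iff {ρ σ : Matrix ι ι ℂ} {C : Set (Matrix ι ι ℂ)} (hρ : IsState ρ)
    (hC : Convex ℝ C) (hpsd : ∀ τ ∈ C, τ.PosSemidef) (hσC : σ ∈ C) (hρσ : ρ * suppProj σ = ρ) :
    (∀ τ ∈ C, relEnt ρ σ ≤ relEnt ρ τ) ↔
      ∀ τ ∈ C, dlogTrace (hpsd σ hσC).1 ρ τ 0 ≤ 1 := by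
  constructor
  · intro h τ hτ
    refine dlogTrace_le_one_of_relEnt_le hρ (hpsd σ hσC) (hpsd τ hτ) hρσ fun s h0 h1 => h _ ?_
    exact hC hσC hτ (sub_nonneg.2 h1.le) h0.le (by ring)
  · intro h τ hτ
    exact relEnt_le_of_dlogTrace_le hρ (hpsd σ hσC) (hpsd τ hτ) hρσ (h τ hτ)

/-- The rotated operator `σ^{-(1+it)/2} ρ σ^{-(1-it)/2}`. -/
def rotOp (ρ σ : Matrix ι ι ℂ) (t : ℝ) : Matrix ι ι ℂ :=
  mpow σ (expL t) * ρ * mpow σ (expR t)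

lemma rtr_mul_rotOp {ρ σ τ : Matrix ι ι ℂ} (hσ : σ.IsHermitian) (t : ℝ) :
    rtr (τ * rotOp ρ σ t) = (∑ i, ∑ j, eigWeight hσ τ ρ i j *
      (powFun (expL t) (hσ.eigenvalues i) * powFun (expR t) (hσ.eigenvalues j))).re := by
  rw [rotOp, mpow_eq_fcalc, mpow_eq_fcalc, rtr, trace_mul_fcalc_mul_fcalc hσ]

lemma intervalIntegrable_weight {ρ σ : Matrix ι ι ℂ} (hρ : ρ.IsHermitian) (hσ : σ.PosSemidef)
    (hρσ : ρ * suppProj σ = ρ) (τ : Matrix ι ι ℂ) (i j : ι) :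
    IntervalIntegrable (fun y => eigWeight hσ.1 τ ρ i j *
      (powFun (expL (freq y)) (hσ.1.eigenvalues i) *
        powFun (expR (freq y)) (hσ.1.eigenvalues j))) volume 0 1 := by
  by_cases hz : hσ.1.eigenvalues i = 0 ∨ hσ.1.eigenvalues j = 0
  · simp [eigWeight_eq_zero hσ.1 hρ hρσ τ i j hz]
  · push Not at hz
    exact (intervalIntegrable_powFun ((hσ.eigenvalues_nonneg i).lt_of_ne' hz.1)
      ((hσ.eigenvalues_nonneg j).lt_of_ne' hz.2)).const_mul _

lemma integral_weight {ρ σ : Matrix ι ι ℂ} (hρ : ρ.IsHermitian) (hσ : σ.PosSemidef)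
    (hρσ : ρ * suppProj σ = ρ) (τ : Matrix ι ι ℂ) (i j : ι) :
    ∫ y in (0 : ℝ)..1, eigWeight hσ.1 τ ρ i j *
      (powFun (expL (freq y)) (hσ.1.eigenvalues i) *
        powFun (expR (freq y)) (hσ.1.eigenvalues j)) =
      eigWeight hσ.1 τ ρ i j *
        ((logDiv (hσ.1.eigenvalues i) (hσ.1.eigenvalues j) : ℝ) : ℂ) := by
  by_cases hz : hσ.1.eigenvalues i = 0 ∨ hσ.1.eigenvalues j = 0
  · simp [eigWeight_eq_zero hσ.1 hρ hρσ τ i j hz]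
  · push Not at hz
    rw [intervalIntegral.integral_const_mul,
      integral_powFun ((hσ.eigenvalues_nonneg i).lt_of_ne' hz.1)
        ((hσ.eigenvalues_nonneg j).lt_of_ne' hz.2)]

omit [DecidableEq ι] in
lemma intervalIntegrable_finsetSum {E : Type*} [NormedAddCommGroup E] {f : ι → ℝ → E} {a b : ℝ}
    (h : ∀ i, IntervalIntegrable (f i) volume a b) :
    IntervalIntegrable (fun y => ∑ i, f i y) volume a b := by
  have := IntervalIntegrable.sum Finset.univ (f := f) fun i _ => h i
  simpa only [Finset.sum_fn] using this

lemma intervalIntegrable_sum_weight {ρ σ : Matrix ι ι ℂ} (hρ : ρ.IsHermitian)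
    (hσ : σ.PosSemidef) (hρσ : ρ * suppProj σ = ρ) (τ : Matrix ι ι ℂ) :
    IntervalIntegrable (fun y => ∑ i, ∑ j, eigWeight hσ.1 τ ρ i j *
      (powFun (expL (freq y)) (hσ.1.eigenvalues i) *
        powFun (expR (freq y)) (hσ.1.eigenvalues j))) volume 0 1 :=
  intervalIntegrable_finsetSum fun i => intervalIntegrable_finsetSum fun j =>
    intervalIntegrable_weight hρ hσ hρσ τ i j

lemma intervalIntegrable_rotOp {ρ σ : Matrix ι ι ℂ} (hρ : ρ.IsHermitian) (hσ : σ.PosSemidef)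
    (hρσ : ρ * suppProj σ = ρ) (τ : Matrix ι ι ℂ) :
    IntervalIntegrable (fun y => rtr (τ * rotOp ρ σ (freq y))) volume 0 1 := by
  have h := intervalIntegrable_sum_weight hρ hσ hρσ τ
  simp only [rtr_mul_rotOp hσ.1]
  rw [intervalIntegrable_iff] at h ⊢
  exact h.re

/-- Integral representation of the differential of the logarithm by rotated operators. -/
lemma integral_rotOp {ρ σ : Matrix ι ι ℂ} (hρ : ρ.IsHermitian) (hσ : σ.PosSemidef)
    (hρσ : ρ * suppProj σ = ρ) (τ : Matrix ι ι ℂ) :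
    ∫ y in (0 : ℝ)..1, rtr (τ * rotOp ρ σ (freq y)) = dlogTrace hσ.1 ρ τ 0 := by
  have h := intervalIntegrable_sum_weight hρ hσ hρσ τ
  simp only [rtr_mul_rotOp hσ.1]
  have hre : ∫ y in (0 : ℝ)..1, (∑ i, ∑ j, eigWeight hσ.1 τ ρ i j *
      (powFun (expL (freq y)) (hσ.1.eigenvalues i) *
        powFun (expR (freq y)) (hσ.1.eigenvalues j))).re =
      (∫ y in (0 : ℝ)..1, ∑ i, ∑ j, eigWeight hσ.1 τ ρ i j *
      (powFun (expL (freq y)) (hσ.1.eigenvalues i) *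
        powFun (expR (freq y)) (hσ.1.eigenvalues j))).re := by
    exact intervalIntegral.intervalIntegral_re (𝕜 := ℂ) h
  rw [hre, intervalIntegral.integral_finsetSum fun i _ => intervalIntegrable_finsetSum
    fun j => intervalIntegrable_weight hρ hσ hρσ τ i j, Complex.re_sum, dlogTrace]
  refine Finset.sum_congr rfl fun i _ => ?_
  rw [intervalIntegral.integral_finsetSum fun j _ => intervalIntegrable_weight hρ hσ hρσ τ i j,
    Complex.re_sum]
  refine Finset.sum_congr rfl fun j _ => ?_
  rw [integral_weight hρ hσ hρσ, Complex.re_mul_ofReal, add_zero, add_zero]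

lemma star_powFun_expL {x : ℝ} (hx : 0 ≤ x) (t : ℝ) :
    star (powFun (expL t) x) = powFun (expR t) x := by
  rcases hx.eq_or_lt with rfl | hx
  · simp [powFun]
  · have hx' : (x : ℂ) ≠ 0 := by exact_mod_cast hx.ne'
    rw [powFun, powFun, if_neg hx.ne', if_neg hx.ne', Complex.cpow_def_of_ne_zero hx',
      Complex.cpow_def_of_ne_zero hx', Complex.star_def, ← Complex.exp_conj, map_mul,
      ← Complex.ofReal_log hx.le, Complex.conj_ofReal]
    simp [expL, expR, sub_eq_add_neg, map_ofNat (starRingEnd ℂ) 2]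

lemma conjTranspose_mpow_expL {σ : Matrix ι ι ℂ} (hσ : σ.PosSemidef) (t : ℝ) :
    (mpow σ (expL t))ᴴ = mpow σ (expR t) := by
  rw [mpow_eq_fcalc, mpow_eq_fcalc, fcalc_of_isHermitian hσ.1, fcalc_of_isHermitian hσ.1,
    Matrix.conjTranspose_mul, Matrix.conjTranspose_mul, Matrix.diagonal_conjTranspose,
    Matrix.star_eq_conjTranspose, Matrix.conjTranspose_conjTranspose, Matrix.mul_assoc]
  congr 3
  ext i
  exact star_powFun_expL (hσ.eigenvalues_nonneg i) t

lemma posSemidef_rotOp {ρ σ : Matrix ι ι ℂ} (hρ : ρ.PosSemidef) (hσ : σ.PosSemidef) (t : ℝ) :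
    (rotOp ρ σ t).PosSemidef := by
  rw [rotOp, ← conjTranspose_mpow_expL hσ]
  exact hρ.mul_mul_conjTranspose_same _

lemma rtr_self_mul_rotOp {ρ σ : Matrix ι ι ℂ} (hρ : IsState ρ) (hσ : σ.PosSemidef)
    (hρσ : ρ * suppProj σ = ρ) (t : ℝ) : rtr (σ * rotOp ρ σ t) = 1 := by
  have hP : mpow σ (expR t) * σ * mpow σ (expL t) = suppProj σ := by
    calc mpow σ (expR t) * σ * mpow σ (expL t)
        = fcalc (powFun (expR t)) σ * fcalc (fun x => (x : ℂ)) σ * fcalc (powFun (expL t)) σ := by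
          rw [fcalc_id hσ.1, mpow_eq_fcalc, mpow_eq_fcalc]
      _ = suppProj σ := by
          rw [fcalc_mul hσ.1, fcalc_mul hσ.1, suppProj]
          refine fcalc_congr hσ fun x hx => ?_
          rcases hx.eq_or_lt with rfl | hx
          · simp [powFun]
          · have hx' : (x : ℂ) ≠ 0 := by exact_mod_cast hx.ne'
            simp only [powFun, if_neg hx.ne']
            nth_rewrite 2 [← Complex.cpow_one (x : ℂ)]
            rw [← Complex.cpow_add _ _ hx', ← Complex.cpow_add _ _ hx']
            congr 1
            simp only [expL, expR]
            ring
  have : (σ * rotOp ρ σ t).trace = ρ.trace := by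
    conv_rhs => rw [← hρσ, ← hP]
    rw [rotOp, Matrix.trace_mul_comm, Matrix.mul_assoc, Matrix.mul_assoc, Matrix.trace_mul_comm,
      Matrix.mul_assoc]
  rw [rtr, this, hρ.2, Complex.one_re]

lemma continuous_rtr_mul_rotOp {ρ σ : Matrix ι ι ℂ} (hσ : σ.PosSemidef) (τ : Matrix ι ι ℂ) :
    Continuous fun t => rtr (τ * rotOp ρ σ t) := by
  have hc : ∀ (x : ℝ) (e : ℝ → ℂ), Continuous e → Continuous fun t => powFun (e t) x := by
    intro x e he
    unfold powFun
    split_ifs with h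
    · exact continuous_const
    · exact he.const_cpow (Or.inl (by exact_mod_cast h))
  have hL : Continuous expL := by unfold expL; fun_prop
  have hR : Continuous expR := by unfold expR; fun_prop
  simp only [rtr_mul_rotOp hσ.1]
  refine Complex.continuous_re.comp (continuous_finsetSum _ fun i _ =>
    continuous_finsetSum _ fun j _ => continuous_const.mul ((hc _ _ hL).mul (hc _ _ hR)))

end Minimizers

section TensorProducts

variable {a b : ℕ}

lemma dtens_eq_submatrix (A : Matrix (Fin a) (Fin a) ℂ) (B : Matrix (Fin b) (Fin b) ℂ) :
    dtens A B = (Matrix.kronecker A B).submatrix finProdFinEquiv.symm finProdFinEquiv.symm := rfl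

lemma dtens_mul_dtens (A C : Matrix (Fin a) (Fin a) ℂ) (B D : Matrix (Fin b) (Fin b) ℂ) :
    dtens A B * dtens C D = dtens (A * C) (B * D) := by
  rw [dtens_eq_submatrix, dtens_eq_submatrix, dtens_eq_submatrix, Matrix.submatrix_mul_equiv]
  exact congrArg (fun M => Matrix.submatrix M _ _) (Matrix.mul_kronecker_mul A C B D).symm

lemma conjTranspose_dtens (A : Matrix (Fin a) (Fin a) ℂ) (B : Matrix (Fin b) (Fin b) ℂ) :
    (dtens A B)ᴴ = dtens Aᴴ Bᴴ := by
  ext x y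
  simp [dtens]

lemma dtens_diagonal (f : Fin a → ℂ) (g : Fin b → ℂ) :
    dtens (Matrix.diagonal f) (Matrix.diagonal g) = Matrix.diagonal fun x =>
      f (finProdFinEquiv.symm x).1 * g (finProdFinEquiv.symm x).2 := by
  ext x y
  by_cases hxy : x = y
  · subst hxy
    simp [dtens]
  · rw [Matrix.diagonal_apply_ne _ hxy]
    by_cases h1 : (finProdFinEquiv.symm x).1 = (finProdFinEquiv.symm y).1
    · have h2 : (finProdFinEquiv.symm x).2 ≠ (finProdFinEquiv.symm y).2 := fun h2 =>
        hxy (finProdFinEquiv.symm.injective (Prod.ext h1 h2))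
      rw [dtens, Matrix.of_apply, Matrix.diagonal_apply_ne _ h2, mul_zero]
    · rw [dtens, Matrix.of_apply, Matrix.diagonal_apply_ne _ h1, zero_mul]

lemma dtens_one_one : dtens (1 : Matrix (Fin a) (Fin a) ℂ) (1 : Matrix (Fin b) (Fin b) ℂ) = 1 := by
  rw [← Matrix.diagonal_one, ← Matrix.diagonal_one, dtens_diagonal]
  simp

lemma trace_dtens (A : Matrix (Fin a) (Fin a) ℂ) (B : Matrix (Fin b) (Fin b) ℂ) :
    (dtens A B).trace = A.trace * B.trace := by
  rw [← Matrix.trace_kronecker, Matrix.trace, Matrix.trace]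
  exact Equiv.sum_comp finProdFinEquiv.symm fun p => Matrix.diag (Matrix.kronecker A B) p

lemma posSemidef_dtens {A : Matrix (Fin a) (Fin a) ℂ} {B : Matrix (Fin b) (Fin b) ℂ}
    (hA : A.PosSemidef) (hB : B.PosSemidef) : (dtens A B).PosSemidef :=
  (hA.kronecker hB).submatrix _

lemma dtens_mem_unitary {U : Matrix (Fin a) (Fin a) ℂ} {V : Matrix (Fin b) (Fin b) ℂ}
    (hU : U ∈ unitary (Matrix (Fin a) (Fin a) ℂ)) (hV : V ∈ unitary (Matrix (Fin b) (Fin b) ℂ)) :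
    dtens U V ∈ unitary (Matrix (Fin (a * b)) (Fin (a * b)) ℂ) := by
  rw [Unitary.mem_iff, Matrix.star_eq_conjTranspose, conjTranspose_dtens, dtens_mul_dtens,
    dtens_mul_dtens]
  rw [Unitary.mem_iff, Matrix.star_eq_conjTranspose] at hU hV
  rw [hU.1, hU.2, hV.1, hV.2, dtens_one_one, and_self]

lemma dtens_conj {A U : Matrix (Fin a) (Fin a) ℂ} {B V : Matrix (Fin b) (Fin b) ℂ} :
    dtens (U * A * star U) (V * B * star V) = dtens U V * dtens A B * star (dtens U V) := by
  rw [Matrix.star_eq_conjTranspose (dtens U V), conjTranspose_dtens, dtens_mul_dtens,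
    dtens_mul_dtens]
  rfl

lemma dtens_fcalc_fcalc {A : Matrix (Fin a) (Fin a) ℂ} {B : Matrix (Fin b) (Fin b) ℂ}
    (hA : A.IsHermitian) (hB : B.IsHermitian) (g h : ℝ → ℂ) :
    dtens (fcalc g A) (fcalc h B) =
      dtens (hA.eigenvectorUnitary : Matrix (Fin a) (Fin a) ℂ) hB.eigenvectorUnitary *
        Matrix.diagonal (fun x => g (hA.eigenvalues (finProdFinEquiv.symm x).1) *
          h (hB.eigenvalues (finProdFinEquiv.symm x).2)) *
        star (dtens (hA.eigenvectorUnitary : Matrix (Fin a) (Fin a) ℂ)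
          hB.eigenvectorUnitary) := by
  rw [fcalc_of_isHermitian hA, fcalc_of_isHermitian hB, dtens_conj, dtens_diagonal]

lemma fcalc_dtens {A : Matrix (Fin a) (Fin a) ℂ} {B : Matrix (Fin b) (Fin b) ℂ}
    (hA : A.IsHermitian) (hB : B.IsHermitian) (f : ℝ → ℂ) :
    fcalc f (dtens A B) =
      dtens (hA.eigenvectorUnitary : Matrix (Fin a) (Fin a) ℂ) hB.eigenvectorUnitary *
        Matrix.diagonal (fun x => f (hA.eigenvalues (finProdFinEquiv.symm x).1 *
          hB.eigenvalues (finProdFinEquiv.symm x).2)) *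
        star (dtens (hA.eigenvectorUnitary : Matrix (Fin a) (Fin a) ℂ)
          hB.eigenvectorUnitary) := by
  conv_lhs => rw [← fcalc_id hA, ← fcalc_id hB]
  rw [dtens_fcalc_fcalc hA hB]
  simp only [← Complex.ofReal_mul]
  exact fcalc_conj_diagonal (dtens_mem_unitary hA.eigenvectorUnitary.2 hB.eigenvectorUnitary.2) _ f

lemma fcalc_dtens_of_mul {A : Matrix (Fin a) (Fin a) ℂ} {B : Matrix (Fin b) (Fin b) ℂ}
    (hA : A.PosSemidef) (hB : B.PosSemidef) {f g h : ℝ → ℂ}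
    (H : ∀ x y, 0 ≤ x → 0 ≤ y → f (x * y) = g x * h y) :
    fcalc f (dtens A B) = dtens (fcalc g A) (fcalc h B) := by
  rw [fcalc_dtens hA.1 hB.1, dtens_fcalc_fcalc hA.1 hB.1]
  simp only [H _ _ (hA.eigenvalues_nonneg _) (hB.eigenvalues_nonneg _)]

lemma mpow_dtens {A : Matrix (Fin a) (Fin a) ℂ} {B : Matrix (Fin b) (Fin b) ℂ}
    (hA : A.PosSemidef) (hB : B.PosSemidef) (w : ℂ) :
    mpow (dtens A B) w = dtens (mpow A w) (mpow B w) := by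
  rw [mpow_eq_fcalc, mpow_eq_fcalc, mpow_eq_fcalc]
  refine fcalc_dtens_of_mul hA hB fun x y hx hy => ?_
  rcases eq_or_ne x 0 with rfl | hx'
  · simp [powFun]
  rcases eq_or_ne y 0 with rfl | hy'
  · simp [powFun]
  rw [powFun, powFun, powFun, if_neg hx', if_neg hy', if_neg (mul_ne_zero hx' hy'),
    Complex.ofReal_mul, Complex.mul_cpow_ofReal_nonneg hx hy]

lemma suppProj_dtens {A : Matrix (Fin a) (Fin a) ℂ} {B : Matrix (Fin b) (Fin b) ℂ}
    (hA : A.PosSemidef) (hB : B.PosSemidef) :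
    suppProj (dtens A B) = dtens (suppProj A) (suppProj B) :=
  mpow_dtens hA hB 0

lemma ofReal_log_mul (x y : ℝ) : ((Real.log (x * y) : ℝ) : ℂ) =
    (Real.log x : ℂ) * powFun 0 y + powFun 0 x * (Real.log y : ℂ) := by
  rcases eq_or_ne x 0 with rfl | hx
  · simp [powFun]
  rcases eq_or_ne y 0 with rfl | hy
  · simp [powFun]
  simp [powFun, hx, hy, Real.log_mul]

lemma mlog_dtens {A : Matrix (Fin a) (Fin a) ℂ} {B : Matrix (Fin b) (Fin b) ℂ}
    (hA : A.PosSemidef) (hB : B.PosSemidef) :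
    mlog (dtens A B) = dtens (mlog A) (suppProj B) + dtens (suppProj A) (mlog B) := by
  rw [mlog_eq_fcalc, mlog_eq_fcalc, mlog_eq_fcalc, suppProj, suppProj, fcalc_dtens hA.1 hB.1,
    dtens_fcalc_fcalc hA.1 hB.1, dtens_fcalc_fcalc hA.1 hB.1, ← Matrix.add_mul, ← Matrix.mul_add,
    Matrix.diagonal_add]
  congr 3
  ext x
  exact ofReal_log_mul _ _

lemma mul_suppProj_dtens {ρ₁ σ₁ : Matrix (Fin a) (Fin a) ℂ} {ρ₂ σ₂ : Matrix (Fin b) (Fin b) ℂ}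
    (hσ₁ : σ₁.PosSemidef) (hσ₂ : σ₂.PosSemidef) (h₁ : ρ₁ * suppProj σ₁ = ρ₁)
    (h₂ : ρ₂ * suppProj σ₂ = ρ₂) : dtens ρ₁ ρ₂ * suppProj (dtens σ₁ σ₂) = dtens ρ₁ ρ₂ := by
  rw [suppProj_dtens hσ₁ hσ₂, dtens_mul_dtens, h₁, h₂]

lemma isState_dtens {ρ₁ : Matrix (Fin a) (Fin a) ℂ} {ρ₂ : Matrix (Fin b) (Fin b) ℂ}
    (h₁ : IsState ρ₁) (h₂ : IsState ρ₂) : IsState (dtens ρ₁ ρ₂) :=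
  ⟨posSemidef_dtens h₁.1 h₂.1, by rw [trace_dtens, h₁.2, h₂.2, one_mul]⟩

lemma rotOp_dtens {σ₁ : Matrix (Fin a) (Fin a) ℂ} {σ₂ : Matrix (Fin b) (Fin b) ℂ}
    (hσ₁ : σ₁.PosSemidef) (hσ₂ : σ₂.PosSemidef) (ρ₁ : Matrix (Fin a) (Fin a) ℂ)
    (ρ₂ : Matrix (Fin b) (Fin b) ℂ) (t : ℝ) :
    rotOp (dtens ρ₁ ρ₂) (dtens σ₁ σ₂) t = dtens (rotOp ρ₁ σ₁ t) (rotOp ρ₂ σ₂ t) := by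
  rw [rotOp, mpow_dtens hσ₁ hσ₂, mpow_dtens hσ₁ hσ₂, dtens_mul_dtens, dtens_mul_dtens, rotOp,
    rotOp]

/-- The value `Tr[ρ log ρ] - Tr[ρ log σ]` of the relative entropy when `supp ρ ⊆ supp σ`. -/
def entropyDiff {ι : Type*} [Fintype ι] [DecidableEq ι] (ρ σ : Matrix ι ι ℂ) : ℝ :=
  rtr (ρ * mlog ρ) - rtr (ρ * mlog σ)

lemma rtr_dtens_mul_mlog {ρ₁ σ₁ : Matrix (Fin a) (Fin a) ℂ} {ρ₂ σ₂ : Matrix (Fin b) (Fin b) ℂ}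
    (hρ₁ : IsState ρ₁) (hρ₂ : IsState ρ₂) (hσ₁ : σ₁.PosSemidef) (hσ₂ : σ₂.PosSemidef)
    (h₁ : ρ₁ * suppProj σ₁ = ρ₁) (h₂ : ρ₂ * suppProj σ₂ = ρ₂) :
    rtr (dtens ρ₁ ρ₂ * mlog (dtens σ₁ σ₂)) = rtr (ρ₁ * mlog σ₁) + rtr (ρ₂ * mlog σ₂) := by
  rw [mlog_dtens hσ₁ hσ₂, Matrix.mul_add, dtens_mul_dtens, dtens_mul_dtens, h₁, h₂, rtr_add, rtr,
    rtr, trace_dtens, trace_dtens, hρ₁.2, hρ₂.2, mul_one, one_mul, rtr, rtr]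

lemma entropyDiff_dtens {ρ₁ σ₁ : Matrix (Fin a) (Fin a) ℂ} {ρ₂ σ₂ : Matrix (Fin b) (Fin b) ℂ}
    (hρ₁ : IsState ρ₁) (hρ₂ : IsState ρ₂) (hσ₁ : σ₁.PosSemidef) (hσ₂ : σ₂.PosSemidef)
    (h₁ : ρ₁ * suppProj σ₁ = ρ₁) (h₂ : ρ₂ * suppProj σ₂ = ρ₂) :
    entropyDiff (dtens ρ₁ ρ₂) (dtens σ₁ σ₂) = entropyDiff ρ₁ σ₁ + entropyDiff ρ₂ σ₂ := by
  rw [entropyDiff, rtr_dtens_mul_mlog hρ₁ hρ₂ hσ₁ hσ₂ h₁ h₂,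
    rtr_dtens_mul_mlog hρ₁ hρ₂ hρ₁.1 hρ₂.1 (self_mul_suppProj hρ₁.1.1)
      (self_mul_suppProj hρ₂.1.1), entropyDiff, entropyDiff]
  ring

end TensorProducts

section TensorPowers

variable {d : ℕ}

lemma dpow_zero (A : Matrix (Fin d) (Fin d) ℂ) : dpow A 0 = 1 := by
  ext x y
  have : x = y := by
    apply Fin.ext
    have hx := x.2
    have hy := y.2
    simp only [pow_zero, Nat.lt_one_iff] at hx hy
    rw [hx, hy]
  subst this
  rw [Matrix.one_apply_eq, dpow, Matrix.of_apply, Fin.prod_univ_zero]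

lemma dpow_one (A : Matrix (Fin d) (Fin d) ℂ) :
    dpow A 1 = A.submatrix (Fin.cast (pow_one d)) (Fin.cast (pow_one d)) := by
  ext x y
  have h : ∀ z : Fin (d ^ 1), finFunctionFinEquiv.symm z 0 = Fin.cast (pow_one d) z := by
    intro z
    apply Fin.ext
    have hz : (z : ℕ) < d := z.2.trans_eq (pow_one d)
    simp [finFunctionFinEquiv, Nat.mod_eq_of_lt hz]
  simp [dpow, h]

lemma dpow_succ (A : Matrix (Fin d) (Fin d) ℂ) (n : ℕ) :
    dpow A (n + 1) = dtens (dpow A n) A := by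
  ext x y
  have h0 : ∀ z : Fin (d ^ (n + 1)), finFunctionFinEquiv.symm z 0 =
      (finProdFinEquiv.symm (z : Fin (d ^ n * d))).2 := by
    intro z
    apply Fin.ext
    simp [finFunctionFinEquiv, finProdFinEquiv, Fin.modNat]
  have hs : ∀ (z : Fin (d ^ (n + 1))) (i : Fin n), finFunctionFinEquiv.symm z i.succ =
      finFunctionFinEquiv.symm (finProdFinEquiv.symm (z : Fin (d ^ n * d))).1 i := by
    intro z i
    apply Fin.ext
    simp [finFunctionFinEquiv, finProdFinEquiv, Fin.divNat, Nat.div_div_eq_div_mul, pow_succ']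
  rw [dpow, Matrix.of_apply, Fin.prod_univ_succ, mul_comm]
  simp only [h0, hs]
  rfl

lemma dpow_mem_of_dtens_mem {T : (e : ℕ) → Set (Matrix (Fin e) (Fin e) ℂ)}
    (hT : ∀ e f, 1 ≤ e → 1 ≤ f → ∀ A ∈ T e, ∀ B ∈ T f, dtens A B ∈ T (e * f)) (hd : 1 ≤ d)
    {A : Matrix (Fin d) (Fin d) ℂ} (hA : A ∈ T d) {n : ℕ} (hn : 1 ≤ n) : dpow A n ∈ T (d ^ n) := by
  induction n, hn using Nat.le_induction with
  | base =>
    rw [dpow_one]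
    have : ∀ (e : ℕ) (h : e = d), A.submatrix (Fin.cast h) (Fin.cast h) ∈ T e := by
      rintro e rfl
      exact hA
    exact this _ _
  | succ n _ ih =>
    rw [dpow_succ]
    exact hT _ _ (Nat.one_le_pow _ _ hd) hd _ ih _ hA

lemma posSemidef_dpow {A : Matrix (Fin d) (Fin d) ℂ} (hA : A.PosSemidef) (n : ℕ) :
    (dpow A n).PosSemidef := by
  induction n with
  | zero =>
    rw [dpow_zero]
    exact Matrix.PosSemidef.one
  | succ n ih =>
    rw [dpow_succ]
    exact posSemidef_dtens ih hA

lemma dpow_mul_dpow (A B : Matrix (Fin d) (Fin d) ℂ) (n : ℕ) :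
    dpow A n * dpow B n = dpow (A * B) n := by
  induction n with
  | zero => simp only [dpow_zero, mul_one]
  | succ n ih =>
    simp only [dpow_succ]
    exact (dtens_mul_dtens _ _ _ _).trans (by rw [ih])

lemma trace_dpow (A : Matrix (Fin d) (Fin d) ℂ) (n : ℕ) : (dpow A n).trace = A.trace ^ n := by
  induction n with
  | zero =>
    rw [dpow_zero, Matrix.trace_one, pow_zero, Fintype.card_fin, pow_zero, Nat.cast_one]
  | succ n ih =>
    rw [dpow_succ]
    exact (trace_dtens _ _).trans (by rw [ih, pow_succ])

lemma isState_dpow {ρ : Matrix (Fin d) (Fin d) ℂ} (hρ : IsState ρ) (n : ℕ) :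
    IsState (dpow ρ n) :=
  ⟨posSemidef_dpow hρ.1 n, by rw [trace_dpow, hρ.2, one_pow]⟩

lemma mpow_one_matrix {ι : Type*} [Fintype ι] [DecidableEq ι] (w : ℂ) :
    mpow (1 : Matrix ι ι ℂ) w = 1 := by
  rw [mpow_eq_fcalc]
  have := fcalc_conj_diagonal (one_mem (unitary (Matrix ι ι ℂ))) (fun _ => 1) (powFun w)
  simpa [powFun] using this

lemma mul_suppProj_dpow {ρ σ : Matrix (Fin d) (Fin d) ℂ} (hσ : σ.PosSemidef)
    (h : ρ * suppProj σ = ρ) (n : ℕ) : dpow ρ n * suppProj (dpow σ n) = dpow ρ n := by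
  induction n with
  | zero =>
    rw [dpow_zero, dpow_zero, suppProj, ← mpow_eq_fcalc, mpow_one_matrix, mul_one]
  | succ n ih =>
    simp only [dpow_succ]
    exact mul_suppProj_dtens (posSemidef_dpow hσ n) hσ ih h

lemma rotOp_dpow {σ : Matrix (Fin d) (Fin d) ℂ} (hσ : σ.PosSemidef)
    (ρ : Matrix (Fin d) (Fin d) ℂ) (t : ℝ) (n : ℕ) :
    rotOp (dpow ρ n) (dpow σ n) t = dpow (rotOp ρ σ t) n := by
  induction n with
  | zero => simp only [rotOp, dpow_zero, mpow_one_matrix, mul_one]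
  | succ n ih =>
    simp only [dpow_succ]
    exact (rotOp_dtens (posSemidef_dpow hσ n) hσ _ _ t).trans (by rw [ih])

lemma entropyDiff_dpow {ρ σ : Matrix (Fin d) (Fin d) ℂ} (hρ : IsState ρ) (hσ : σ.PosSemidef)
    (h : ρ * suppProj σ = ρ) (n : ℕ) :
    entropyDiff (dpow ρ n) (dpow σ n) = n * entropyDiff ρ σ := by
  induction n with
  | zero => simp only [dpow_zero, entropyDiff, sub_self, Nat.cast_zero, zero_mul]
  | succ n ih =>
    simp only [dpow_succ]
    refine (entropyDiff_dtens (isState_dpow hρ n) hρ (posSemidef_dpow hσ n) hσ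
      (mul_suppProj_dpow hσ h n) h).trans ?_
    rw [ih]
    push_cast
    ring

end TensorPowers

section StrongAdditivity

variable {ι : Type*} [Fintype ι] [DecidableEq ι]

lemma relEnt_eq_entropyDiff {ρ σ : Matrix ι ι ℂ} (hρ : ρ.IsHermitian) (hσ : σ.IsHermitian)
    (h : ρ * suppProj σ = ρ) : relEnt ρ σ = (entropyDiff ρ σ : EReal) :=
  relEnt_of_mul_suppProj hρ hσ h

lemma mul_suppProj_of_minimizer {ρ σ : Matrix ι ι ℂ} {C : Set (Matrix ι ι ℂ)}
    (hρ : ρ.IsHermitian) (hσ : σ.IsHermitian) (hC : ∃ τ ∈ C, IsState τ ∧ msupp ρ ≤ msupp τ)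
    (hmin : ∀ τ ∈ C, relEnt ρ σ ≤ relEnt ρ τ) : ρ * suppProj σ = ρ := by
  by_contra h
  obtain ⟨τ, hτ, hτs, hρτ⟩ := hC
  have hle := hmin τ hτ
  rw [relEnt_of_mul_suppProj_ne hρ hσ h,
    relEnt_of_mul_suppProj hρ hτs.1.1 ((msupp_le_iff hρ hτs.1.1).1 hρτ)] at hle
  exact EReal.coe_ne_top _ (top_le_iff.1 hle)

omit [Fintype ι] [DecidableEq ι] in
lemma biInf_eq_iff_forall_le {α : Type*} {C : Set α} {F : α → EReal} {x : α} (hx : x ∈ C) :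
    (⨅ y ∈ C, F y) = F x ↔ ∀ y ∈ C, F x ≤ F y := by
  constructor
  · intro h y hy
    rw [← h]
    exact iInf₂_le y hy
  · intro h
    exact le_antisymm (iInf₂_le x hx) (le_iInf₂ h)

lemma iSup_rotOp_eq_one_iff {ρ σ : Matrix ι ι ℂ} {C : Set (Matrix ι ι ℂ)} (hρ : IsState ρ)
    (hσ : σ.PosSemidef) (hσC : σ ∈ C) (hρσ : ρ * suppProj σ = ρ) :
    (⨆ t : ℝ, ⨆ τ ∈ C, ((rtr (τ * rotOp ρ σ t) : ℝ) : EReal)) = 1 ↔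
      ∀ t, ∀ τ ∈ C, rtr (τ * rotOp ρ σ t) ≤ 1 := by
  constructor
  · intro h t τ hτ
    rw [← EReal.coe_le_coe_iff, EReal.coe_one, ← h]
    exact le_iSup_of_le t (le_iSup₂_of_le τ hτ le_rfl)
  · intro h
    refine le_antisymm (iSup_le fun t => iSup₂_le fun τ hτ => ?_) ?_
    · exact_mod_cast h t τ hτ
    · refine le_iSup_of_le 0 (le_iSup₂_of_le σ hσC ?_)
      rw [rtr_self_mul_rotOp hρ hσ hρσ, EReal.coe_one]

lemma dlogTrace_le_one_of_rotOp_le {ρ σ τ : Matrix ι ι ℂ} (hρ : ρ.IsHermitian)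
    (hσ : σ.PosSemidef) (hρσ : ρ * suppProj σ = ρ) (h : ∀ t, rtr (τ * rotOp ρ σ t) ≤ 1) :
    dlogTrace hσ.1 ρ τ 0 ≤ 1 := by
  rw [← integral_rotOp hρ hσ hρσ]
  calc ∫ y in (0 : ℝ)..1, rtr (τ * rotOp ρ σ (freq y)) ≤ ∫ _ in (0 : ℝ)..1, (1 : ℝ) :=
        intervalIntegral.integral_mono_on zero_le_one (intervalIntegrable_rotOp hρ hσ hρσ τ)
          intervalIntegrable_const fun y _ => h _
    _ = 1 := by simp

lemma le_one_of_integral_pow_le_one {f : ℝ → ℝ} (hf : Continuous f) (h0 : ∀ t, 0 ≤ f t)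
    (hint : ∀ n : ℕ, 1 ≤ n → IntervalIntegrable (fun y => f (freq y) ^ n) volume 0 1)
    (hle : ∀ n : ℕ, 1 ≤ n → ∫ y in (0 : ℝ)..1, f (freq y) ^ n ≤ 1) (t : ℝ) : f t ≤ 1 := by
  by_contra! ht
  obtain ⟨y₀, hy₀, rfl⟩ := freq_surjective t
  obtain ⟨c, hc1, hct⟩ := exists_between ht
  let U : Set ℝ := Ioo 0 1 ∩ (fun y => f (freq y)) ⁻¹' Ioi c
  have hUo : IsOpen U :=
    (hf.comp_continuousOn continuousOn_freq).isOpen_inter_preimage isOpen_Ioo isOpen_Ioi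
  have hUpos : 0 < volume U := hUo.measure_pos volume ⟨y₀, hy₀, hct⟩
  have hUfin : volume U ≠ ⊤ :=
    measure_ne_top_of_subset inter_subset_left (by simp)
  have hμ : 0 < volume.real U := ENNReal.toReal_pos hUpos.ne' hUfin
  have hbound : ∀ n : ℕ, 1 ≤ n → c ^ n * volume.real U ≤ 1 := by
    intro n hn
    have hi := hint n hn
    rw [intervalIntegrable_iff_integrableOn_Ioo_of_le zero_le_one] at hi
    refine le_trans ?_ (hle n hn)
    rw [intervalIntegral.integral_of_le zero_le_one, integral_Ioc_eq_integral_Ioo]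
    calc c ^ n * volume.real U = ∫ _ in U, c ^ n := by
          rw [setIntegral_const, smul_eq_mul, mul_comm]
      _ ≤ ∫ y in U, f (freq y) ^ n := by
          refine setIntegral_mono_on (integrableOn_const hUfin) (hi.mono_set inter_subset_left)
            hUo.measurableSet fun y hy => ?_
          exact pow_le_pow_left₀ (zero_le_one.trans hc1.le) (le_of_lt hy.2) n
      _ ≤ ∫ y in Ioo (0 : ℝ) 1, f (freq y) ^ n :=
          setIntegral_mono_set hi (Eventually.of_forall fun y => pow_nonneg (h0 _) n)
            (LE.le.eventuallyLE inter_subset_left)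
  obtain ⟨n, hn⟩ := pow_unbounded_of_one_lt (1 / volume.real U) hc1
  have h1 := hbound (n + 1) (by omega)
  have h2 : c ^ n ≤ c ^ (n + 1) := pow_le_pow_right₀ hc1.le (Nat.le_succ n)
  rw [div_lt_iff₀ hμ] at hn
  nlinarith

omit [DecidableEq ι] in
lemma ofReal_rtr_mul {A B : Matrix ι ι ℂ} (hA : A.IsHermitian) (hB : B.IsHermitian) :
    ((rtr (A * B) : ℝ) : ℂ) = (A * B).trace := by
  refine Complex.conj_eq_iff_re.1 ?_
  rw [← Complex.star_def, ← Matrix.trace_conjTranspose, Matrix.conjTranspose_mul, hA.eq, hB.eq,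
    Matrix.trace_mul_comm]

variable {d₁ d₂ : ℕ}

lemma rtr_mul_rotOp_dtens_dpow {ρ₁ σ₁ τ₁ : Matrix (Fin d₁) (Fin d₁) ℂ}
    {ρ₂ σ₂ τ₂ : Matrix (Fin d₂) (Fin d₂) ℂ} (hρ₁ : ρ₁.PosSemidef) (hρ₂ : ρ₂.PosSemidef)
    (hσ₁ : σ₁.PosSemidef) (hσ₂ : σ₂.PosSemidef) (hτ₁ : τ₁.PosSemidef) (hτ₂ : τ₂.PosSemidef)
    (n m : ℕ) (t : ℝ) :
    rtr (dtens (dpow τ₁ n) (dpow τ₂ m) *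
      rotOp (dtens (dpow ρ₁ n) (dpow ρ₂ m)) (dtens (dpow σ₁ n) (dpow σ₂ m)) t) =
      rtr (τ₁ * rotOp ρ₁ σ₁ t) ^ n * rtr (τ₂ * rotOp ρ₂ σ₂ t) ^ m := by
  rw [rotOp_dtens (posSemidef_dpow hσ₁ n) (posSemidef_dpow hσ₂ m), rotOp_dpow hσ₁,
    rotOp_dpow hσ₂, dtens_mul_dtens, dpow_mul_dpow, dpow_mul_dpow, rtr, trace_dtens, trace_dpow,
    trace_dpow, ← ofReal_rtr_mul hτ₁.1 (posSemidef_rotOp hρ₁ hσ₁ t).1,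
    ← ofReal_rtr_mul hτ₂.1 (posSemidef_rotOp hρ₂ hσ₂ t).1, ← Complex.ofReal_pow,
    ← Complex.ofReal_pow, ← Complex.ofReal_mul, Complex.ofReal_re]


lemma biInf_relEnt_dtens_dpow_eq_iff {ρ₁ σ₁ : Matrix (Fin d₁) (Fin d₁) ℂ}
    {ρ₂ σ₂ : Matrix (Fin d₂) (Fin d₂) ℂ} (hρ₁ : IsState ρ₁) (hρ₂ : IsState ρ₂)
    (hσ₁ : σ₁.PosSemidef) (hσ₂ : σ₂.PosSemidef) (h₁ : ρ₁ * suppProj σ₁ = ρ₁)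
    (h₂ : ρ₂ * suppProj σ₂ = ρ₂) {n m : ℕ}
    {C : Set (Matrix (Fin (d₁ ^ n * d₂ ^ m)) (Fin (d₁ ^ n * d₂ ^ m)) ℂ)} (hC : Convex ℝ C)
    (hpsd : ∀ τ ∈ C, τ.PosSemidef) (hmem : dtens (dpow σ₁ n) (dpow σ₂ m) ∈ C) :
    (⨅ σ ∈ C, relEnt (dtens (dpow ρ₁ n) (dpow ρ₂ m)) σ) =
        ((n : ℝ) : EReal) * relEnt ρ₁ σ₁ + ((m : ℝ) : EReal) * relEnt ρ₂ σ₂ ↔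
      ∀ τ ∈ C, dlogTrace (hpsd _ hmem).1 (dtens (dpow ρ₁ n) (dpow ρ₂ m)) τ 0 ≤ 1 := by
  have hρ := isState_dtens (isState_dpow hρ₁ n) (isState_dpow hρ₂ m)
  have hn := mul_suppProj_dpow hσ₁ h₁ n
  have hm := mul_suppProj_dpow hσ₂ h₂ m
  have hσn := posSemidef_dpow hσ₁ n
  have hσm := posSemidef_dpow hσ₂ m
  have hsupp := mul_suppProj_dtens hσn hσm hn hm
  have hval : ((n : ℝ) : EReal) * relEnt ρ₁ σ₁ + ((m : ℝ) : EReal) * relEnt ρ₂ σ₂ =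
      relEnt (dtens (dpow ρ₁ n) (dpow ρ₂ m)) (dtens (dpow σ₁ n) (dpow σ₂ m)) := by
    rw [relEnt_eq_entropyDiff hρ₁.1.1 hσ₁.1 h₁, relEnt_eq_entropyDiff hρ₂.1.1 hσ₂.1 h₂,
      relEnt_eq_entropyDiff hρ.1.1 (hpsd _ hmem).1 hsupp,
      entropyDiff_dtens (isState_dpow hρ₁ n) (isState_dpow hρ₂ m) hσn hσm hn hm,
      entropyDiff_dpow hρ₁ hσ₁ h₁, entropyDiff_dpow hρ₂ hσ₂ h₂, EReal.coe_add, EReal.coe_mul,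
      EReal.coe_mul]
  rw [hval, biInf_eq_iff_forall_le hmem, relEnt_minimizer_iff hρ hC hpsd hmem hsupp]

/-- If every power of `Tr[τ σ^{-(1+it)/2} ρ σ^{-(1-it)/2}]` is realized by a system on which the
differential of the logarithm is bounded by one, then the trace itself is bounded by one. -/
lemma rtr_mul_rotOp_le_one {ρ σ τ : Matrix ι ι ℂ} (hρ : ρ.PosSemidef) (hσ : σ.PosSemidef)
    (hτ : τ.PosSemidef)
    (H : ∀ n : ℕ, 1 ≤ n → ∃ (e : ℕ) (R P T : Matrix (Fin e) (Fin e) ℂ) (hP : P.PosSemidef),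
      R.IsHermitian ∧ R * suppProj P = R ∧
      (∀ t, rtr (T * rotOp R P t) = rtr (τ * rotOp ρ σ t) ^ n) ∧ dlogTrace hP.1 R T 0 ≤ 1)
    (t : ℝ) : rtr (τ * rotOp ρ σ t) ≤ 1 := by
  refine le_one_of_integral_pow_le_one (f := fun t => rtr (τ * rotOp ρ σ t))
    (continuous_rtr_mul_rotOp hσ τ) (fun t => rtr_mul_nonneg hτ (posSemidef_rotOp hρ hσ t))
    (fun n hn => ?_) (fun n hn => ?_) t
  · obtain ⟨e, R, P, T, hP, hR, hRP, hT, -⟩ := H n hn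
    simpa only [hT] using intervalIntegrable_rotOp hR hP hRP T
  · obtain ⟨e, R, P, T, hP, hR, hRP, hT, hle⟩ := H n hn
    rw [← integral_rotOp hR hP hRP] at hle
    simpa only [hT] using hle

lemma dtens_dpow_mem {T : (e : ℕ) → Set (Matrix (Fin e) (Fin e) ℂ)}
    (hT : ∀ e f, 1 ≤ e → 1 ≤ f → ∀ A ∈ T e, ∀ B ∈ T f, dtens A B ∈ T (e * f)) (hd₁ : 1 ≤ d₁)
    (hd₂ : 1 ≤ d₂) {A : Matrix (Fin d₁) (Fin d₁) ℂ} {B : Matrix (Fin d₂) (Fin d₂) ℂ}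
    (hA : A ∈ T d₁) (hB : B ∈ T d₂) {n m : ℕ} (hn : 1 ≤ n) (hm : 1 ≤ m) :
    dtens (dpow A n) (dpow B m) ∈ T (d₁ ^ n * d₂ ^ m) :=
  hT _ _ (Nat.one_le_pow _ _ hd₁) (Nat.one_le_pow _ _ hd₂) _ (dpow_mem_of_dtens_mem hT hd₁ hA hn)
    _ (dpow_mem_of_dtens_mem hT hd₂ hB hm)

lemma forall_rtr_mul_rotOp_le_one_iff (hd₁ : 1 ≤ d₁) (hd₂ : 1 ≤ d₂)
    {S : (d : ℕ) → Set (Matrix (Fin d) (Fin d) ℂ)} (hS : Assumption1' S)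
    {ρ₁ σ₁ : Matrix (Fin d₁) (Fin d₁) ℂ} {ρ₂ σ₂ : Matrix (Fin d₂) (Fin d₂) ℂ}
    (hρ₁ : IsState ρ₁) (hρ₂ : IsState ρ₂) (hσ₁ : σ₁ ∈ S d₁) (hσ₂ : σ₂ ∈ S d₂)
    (h₁ : ρ₁ * suppProj σ₁ = ρ₁) (h₂ : ρ₂ * suppProj σ₂ = ρ₂) :
    (∀ m n : ℕ, 1 ≤ m → 1 ≤ n →
        (⨅ σ ∈ S (d₁ ^ n * d₂ ^ m), relEnt (dtens (dpow ρ₁ n) (dpow ρ₂ m)) σ) =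
          ((n : ℝ) : EReal) * relEnt ρ₁ σ₁ + ((m : ℝ) : EReal) * relEnt ρ₂ σ₂) ↔
      (∀ t, ∀ τ ∈ S d₁, rtr (τ * rotOp ρ₁ σ₁ t) ≤ 1) ∧
        ∀ t, ∀ τ ∈ S d₂, rtr (τ * rotOp ρ₂ σ₂ t) ≤ 1 := by
  have hs₁ := hS.psd d₁ hd₁ σ₁ hσ₁
  have hs₂ := hS.psd d₂ hd₂ σ₂ hσ₂
  have hdim : ∀ n m : ℕ, 1 ≤ d₁ ^ n * d₂ ^ m := fun n m =>
    Nat.mul_pos (Nat.one_le_pow _ _ hd₁) (Nat.one_le_pow _ _ hd₂)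
  have hmem : ∀ n m : ℕ, 1 ≤ n → 1 ≤ m →
      dtens (dpow σ₁ n) (dpow σ₂ m) ∈ S (d₁ ^ n * d₂ ^ m) := fun n m hn hm =>
    dtens_dpow_mem hS.tens hd₁ hd₂ hσ₁ hσ₂ hn hm
  have hherm : ∀ n m : ℕ, (dtens (dpow ρ₁ n) (dpow ρ₂ m)).IsHermitian := fun n m =>
    (posSemidef_dtens (posSemidef_dpow hρ₁.1 n) (posSemidef_dpow hρ₂.1 m)).1
  have hsupp : ∀ n m : ℕ, dtens (dpow ρ₁ n) (dpow ρ₂ m) *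
      suppProj (dtens (dpow σ₁ n) (dpow σ₂ m)) = dtens (dpow ρ₁ n) (dpow ρ₂ m) := fun n m =>
    mul_suppProj_dtens (posSemidef_dpow hs₁ n) (posSemidef_dpow hs₂ m)
      (mul_suppProj_dpow hs₁ h₁ n) (mul_suppProj_dpow hs₂ h₂ m)
  have hiff := fun (n m : ℕ) (hn : 1 ≤ n) (hm : 1 ≤ m) =>
    biInf_relEnt_dtens_dpow_eq_iff hρ₁ hρ₂ hs₁ hs₂ h₁ h₂ (hS.convex _ (hdim n m))
      (hS.psd _ (hdim n m)) (hmem n m hn hm)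
  constructor
  · intro h
    refine ⟨fun t τ hτ => ?_, fun t τ hτ => ?_⟩
    · refine rtr_mul_rotOp_le_one hρ₁.1 hs₁ (hS.psd _ hd₁ _ hτ) (fun n hn => ?_) t
      refine ⟨_, dtens (dpow ρ₁ n) (dpow ρ₂ 1), dtens (dpow σ₁ n) (dpow σ₂ 1),
        dtens (dpow τ n) (dpow σ₂ 1), hS.psd _ (hdim n 1) _ (hmem n 1 hn le_rfl), hherm n 1,
        hsupp n 1, fun s => ?_, (hiff n 1 hn le_rfl).1 (h 1 n le_rfl hn) _
          (dtens_dpow_mem hS.tens hd₁ hd₂ hτ hσ₂ hn le_rfl)⟩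
      rw [rtr_mul_rotOp_dtens_dpow hρ₁.1 hρ₂.1 hs₁ hs₂ (hS.psd _ hd₁ _ hτ) hs₂,
        rtr_self_mul_rotOp hρ₂ hs₂ h₂, one_pow, mul_one]
    · refine rtr_mul_rotOp_le_one hρ₂.1 hs₂ (hS.psd _ hd₂ _ hτ) (fun m hm => ?_) t
      refine ⟨_, dtens (dpow ρ₁ 1) (dpow ρ₂ m), dtens (dpow σ₁ 1) (dpow σ₂ m),
        dtens (dpow σ₁ 1) (dpow τ m), hS.psd _ (hdim 1 m) _ (hmem 1 m le_rfl hm), hherm 1 m,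
        hsupp 1 m, fun s => ?_, (hiff 1 m le_rfl hm).1 (h m 1 hm le_rfl) _
          (dtens_dpow_mem hS.tens hd₁ hd₂ hσ₁ hτ le_rfl hm)⟩
      rw [rtr_mul_rotOp_dtens_dpow hρ₁.1 hρ₂.1 hs₁ hs₂ hs₁ (hS.psd _ hd₂ _ hτ),
        rtr_self_mul_rotOp hρ₁ hs₁ h₁, one_pow, one_mul]
  · rintro ⟨hX₁, hX₂⟩ m n hm hn
    refine (hiff n m hn hm).2 fun τ hτ => dlogTrace_le_one_of_rotOp_le (hherm n m)
      (hS.psd _ (hdim n m) _ (hmem n m hn hm)) (hsupp n m) fun t => ?_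
    have hp₁ : rotOp ρ₁ σ₁ t ∈ polar (S d₁) := ⟨posSemidef_rotOp hρ₁.1 hs₁ t, fun Y hY => by
      rw [rtr, Matrix.trace_mul_comm]
      exact hX₁ t Y hY⟩
    have hp₂ : rotOp ρ₂ σ₂ t ∈ polar (S d₂) := ⟨posSemidef_rotOp hρ₂.1 hs₂ t, fun Y hY => by
      rw [rtr, Matrix.trace_mul_comm]
      exact hX₂ t Y hY⟩
    have hp := dtens_dpow_mem (T := fun e => polar (S e)) hS.polarTens hd₁ hd₂ hp₁ hp₂ hn hm
    rw [rotOp_dtens (posSemidef_dpow hs₁ n) (posSemidef_dpow hs₂ m), rotOp_dpow hs₁,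
      rotOp_dpow hs₂, rtr, Matrix.trace_mul_comm]
    exact hp.2 τ hτ

end StrongAdditivity

end

/-- Theorem 9 of the paper: single-copy criterion for strong additivity of
the minimized Umegaki relative entropy for a dimension-indexed family satisfying
Assumption 1′. -/
theorem umegaki_strong_additivity_iff {d₁ d₂ : ℕ} (hd₁ : 1 ≤ d₁) (hd₂ : 1 ≤ d₂)
    (ρ₁ : Matrix (Fin d₁) (Fin d₁) ℂ) (ρ₂ : Matrix (Fin d₂) (Fin d₂) ℂ)
    (hρ₁ : IsState ρ₁) (hρ₂ : IsState ρ₂)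
    (S : (d : ℕ) → Set (Matrix (Fin d) (Fin d) ℂ)) (hS : Assumption1' S)
    (hsupp₁ : ∃ τ ∈ S d₁, IsState τ ∧ msupp ρ₁ ≤ msupp τ)
    (hsupp₂ : ∃ τ ∈ S d₂, IsState τ ∧ msupp ρ₂ ≤ msupp τ)
    (hperm : ∀ k : ℕ, ∀ π : Equiv.Perm (Fin k),
      (∀ A ∈ S (d₁ ^ k), permMat d₁ k π A ∈ S (d₁ ^ k)) ∧
      (∀ A ∈ S (d₂ ^ k), permMat d₂ k π A ∈ S (d₂ ^ k)) ∧
      (∀ A ∈ S ((d₁ * d₂) ^ k), permMat (d₁ * d₂) k π A ∈ S ((d₁ * d₂) ^ k)))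
    (σ₁ : Matrix (Fin d₁) (Fin d₁) ℂ) (hσ₁ : σ₁ ∈ S d₁)
    (hmin₁ : ∀ σ ∈ S d₁, relEnt ρ₁ σ₁ ≤ relEnt ρ₁ σ)
    (σ₂ : Matrix (Fin d₂) (Fin d₂) ℂ) (hσ₂ : σ₂ ∈ S d₂)
    (hmin₂ : ∀ σ ∈ S d₂, relEnt ρ₂ σ₂ ≤ relEnt ρ₂ σ) :
    (∀ m n : ℕ, 1 ≤ m → 1 ≤ n →
        (⨅ σ ∈ S (d₁ ^ n * d₂ ^ m), relEnt (dtens (dpow ρ₁ n) (dpow ρ₂ m)) σ) =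
          ((n : ℝ) : EReal) * (⨅ σ ∈ S d₁, relEnt ρ₁ σ) +
            ((m : ℝ) : EReal) * (⨅ σ ∈ S d₂, relEnt ρ₂ σ)) ↔
      ((⨆ t : ℝ, ⨆ τ ∈ S d₁,
          ((rtr (τ * (mpow σ₁ (-((1 : ℂ) + Complex.I * (t : ℂ)) / 2) * ρ₁ *
            mpow σ₁ (-((1 : ℂ) - Complex.I * (t : ℂ)) / 2))) : ℝ) : EReal)) = 1 ∧
        (⨆ t : ℝ, ⨆ τ ∈ S d₂,
          ((rtr (τ * (mpow σ₂ (-((1 : ℂ) + Complex.I * (t : ℂ)) / 2) * ρ₂ *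
            mpow σ₂ (-((1 : ℂ) - Complex.I * (t : ℂ)) / 2))) : ℝ) : EReal)) = 1) := by
  have hs₁ := hS.psd d₁ hd₁ σ₁ hσ₁
  have hs₂ := hS.psd d₂ hd₂ σ₂ hσ₂
  have h₁ := mul_suppProj_of_minimizer hρ₁.1.1 hs₁.1 hsupp₁ hmin₁
  have h₂ := mul_suppProj_of_minimizer hρ₂.1.1 hs₂.1 hsupp₂ hmin₂
  rw [(biInf_eq_iff_forall_le hσ₁).2 hmin₁, (biInf_eq_iff_forall_le hσ₂).2 hmin₂,
    forall_rtr_mul_rotOp_le_one_iff hd₁ hd₂ hS hρ₁ hρ₂ hσ₁ hσ₂ h₁ h₂,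
    ← iSup_rotOp_eq_one_iff hρ₁ hs₁ hσ₁ h₁, ← iSup_rotOp_eq_one_iff hρ₂ hs₂ hσ₂ h₂]
  rfl

end QHT
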